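/- arXiv:2512.12639 — 2 statements merged into one kernel-verified Lean document; each statement's English description precedes it below -/
import Mathlib

section
/- Let u : ℝ^m → ℝ^n be an affine map, u(x) = u₀ + A x with A : ℝ^m → ℝ^n linear satisfying A ∘ A* = λ² id_{ℝ^n} for a constant λ ≥ 0 (i.e. u is totally geodesic and horizontally conformal with dilation λ). Then for every smooth map f : ℝ^n → ℝ^ℓ and every x ∈ ℝ^m, div σ_{f∘u}(x) = λ⁴ · (div σ_f)(u(x)). -/
noncomputable section

open ContinuousLinearMap

/-- Euclidean space ℝ^n. -/
abbrev Euc (n : ℕ) : Type := EuclideanSpace ℝ (Fin n)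

/-- The stress field `σ_v(x) = Dv(x) ∘ Dv(x)* ∘ Dv(x)` of a map `v : ℝ^a → F`. -/
def stress {a : ℕ} {F : Type*} [NormedAddCommGroup F] [InnerProductSpace ℝ F]
    [CompleteSpace F] (v : Euc a → F) (x : Euc a) : Euc a →L[ℝ] F :=
  (fderiv ℝ v x) ∘L (ContinuousLinearMap.adjoint (fderiv ℝ v x)) ∘L (fderiv ℝ v x)

/-- Divergence of a field of linear maps: `div τ(x) = Σ_β D(y ↦ τ(y)(e_β))(x)(e_β)`. -/
def divF {a : ℕ} {F : Type*} [NormedAddCommGroup F] [NormedSpace ℝ F]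
    (τ : Euc a → (Euc a →L[ℝ] F)) (x : Euc a) : F :=
  ∑ β : Fin a, fderiv ℝ (fun y => τ y (EuclideanSpace.single β (1 : ℝ))) x
    (EuclideanSpace.single β (1 : ℝ))

theorem differentiable_adjoint {E F : Type*} [NormedAddCommGroup E] [InnerProductSpace ℝ E]
    [CompleteSpace E] [NormedAddCommGroup F] [InnerProductSpace ℝ F] [CompleteSpace F] :
    Differentiable ℝ (fun B : E →L[ℝ] F => ContinuousLinearMap.adjoint B) := by
  have h : IsBoundedLinearMap ℝ (fun B : E →L[ℝ] F => ContinuousLinearMap.adjoint B) :=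
    { map_add := fun B C => map_add _ B C
      map_smul := fun c B => by simp
      bound := ⟨1, one_pos, fun B => by simp⟩ }
  exact h.differentiable

theorem differentiable_stress {n : ℕ} {F : Type*} [NormedAddCommGroup F] [InnerProductSpace ℝ F]
    [CompleteSpace F] {f : Euc n → F} (hf : ContDiff ℝ 2 f) : Differentiable ℝ (stress f) := by
  have hd : Differentiable ℝ (fderiv ℝ f) :=
    (hf.fderiv_right (m := 1) (by norm_num)).differentiable (by norm_num)
  exact hd.clm_comp ((differentiable_adjoint.comp hd).clm_comp hd)

/-- The divergence of a differentiable field is the trace of its derivative. -/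
theorem divF_eq_sum {a : ℕ} {F : Type*} [NormedAddCommGroup F] [NormedSpace ℝ F]
    {τ : Euc a → (Euc a →L[ℝ] F)} {x : Euc a} {T : Euc a →L[ℝ] Euc a →L[ℝ] F}
    (hτ : HasFDerivAt τ T x) :
    divF τ x = ∑ β : Fin a,
      T (EuclideanSpace.single β (1 : ℝ)) (EuclideanSpace.single β (1 : ℝ)) := by
  refine Finset.sum_congr rfl fun β _ => ?_
  rw [(hτ.clm_apply (hasFDerivAt_const (EuclideanSpace.single β (1 : ℝ)) x)).fderiv]
  simp

/-- The trace of the pullback of a bilinear map along `A` with `A ∘ A* = c • id`. -/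
theorem sum_bilinear_comp_of_comp_adjoint {m n : ℕ} {F : Type*} [NormedAddCommGroup F]
    [NormedSpace ℝ F] {A : Euc m →L[ℝ] Euc n} {c : ℝ}
    (hA : A ∘L (ContinuousLinearMap.adjoint A) = c • ContinuousLinearMap.id ℝ (Euc n))
    (T : Euc n →L[ℝ] Euc n →L[ℝ] F) :
    ∑ β : Fin m, T (A (EuclideanSpace.single β (1 : ℝ))) (A (EuclideanSpace.single β (1 : ℝ)))
      = c • ∑ i : Fin n,
        T (EuclideanSpace.single i (1 : ℝ)) (EuclideanSpace.single i (1 : ℝ)) := by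
  let e := EuclideanSpace.basisFun (Fin m) ℝ
  let b := EuclideanSpace.basisFun (Fin n) ℝ
  have hT : ∀ v w : Euc n,
      T v w = ∑ i, ∑ j, (inner ℝ (b i) v * inner ℝ (b j) w) • T (b i) (b j) := by
    intro v w
    conv_lhs => rw [← b.sum_repr' v, ← b.sum_repr' w]
    simp only [map_sum, map_smul, _root_.sum_apply, _root_.smul_apply,
      Finset.smul_sum, smul_smul]
    rw [Finset.sum_comm]
    simp only [mul_comm]
  have hAb : ∀ i j, ∑ β, inner ℝ (b i) (A (e β)) * inner ℝ (b j) (A (e β))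
      = if i = j then c else 0 := by
    intro i j
    have h := e.sum_inner_mul_inner (ContinuousLinearMap.adjoint A (b i))
      (ContinuousLinearMap.adjoint A (b j))
    have hj : A (ContinuousLinearMap.adjoint A (b j)) = c • b j := by
      simpa using congrArg (fun B => B (b j)) hA
    rw [ContinuousLinearMap.adjoint_inner_left, hj, inner_smul_right,
      orthonormal_iff_ite.mp b.orthonormal i j, mul_ite, mul_one, mul_zero] at h
    rw [← h]
    refine Finset.sum_congr rfl fun β _ => ?_
    rw [ContinuousLinearMap.adjoint_inner_left, ContinuousLinearMap.adjoint_inner_right,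
      real_inner_comm (b j)]
  have key : ∑ β, T (A (e β)) (A (e β)) = c • ∑ i, T (b i) (b i) := by
    calc ∑ β, T (A (e β)) (A (e β))
        = ∑ i, ∑ j, (∑ β, inner ℝ (b i) (A (e β)) * inner ℝ (b j) (A (e β))) • T (b i) (b j) := by
          simp only [fun β => hT (A (e β)) (A (e β)), Finset.sum_smul]
          rw [Finset.sum_comm]
          exact Finset.sum_congr rfl fun i _ => Finset.sum_comm
      _ = c • ∑ i, T (b i) (b i) := by
          simp [hAb, ite_smul, Finset.smul_sum]
  simpa [e, b] using key

/-- The stress field of the composition with a horizontally conformal affine map. -/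
theorem stress_comp {m n : ℕ} {F : Type*} [NormedAddCommGroup F] [InnerProductSpace ℝ F]
    [CompleteSpace F] {A : Euc m →L[ℝ] Euc n} {c : ℝ}
    (hA : A ∘L (ContinuousLinearMap.adjoint A) = c • ContinuousLinearMap.id ℝ (Euc n))
    {u : Euc m → Euc n} {f : Euc n → F} {x : Euc m} (hu : HasFDerivAt u A x)
    (hf : DifferentiableAt ℝ f (u x)) :
    stress (f ∘ u) x = c • (stress f (u x) ∘L A) := by
  have hA' : ∀ v, A (ContinuousLinearMap.adjoint A v) = c • v := fun v => by
    simpa using congrArg (fun B => B v) hA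
  ext1 v
  simp [stress, (hf.hasFDerivAt.comp x hu).fderiv, ContinuousLinearMap.adjoint_comp, hA']

/-- if `u(x) = u₀ + A x` is affine with `A ∘ A* = λ² id` (totally geodesic and
horizontally conformal with dilation `λ ≥ 0`), then for every smooth `f : ℝ^n → ℝ^ℓ` and
every `x`, `div σ_{f∘u}(x) = λ⁴ · (div σ_f)(u(x))`. -/
theorem stmt0 {m n ℓ : ℕ} (u₀ : Euc n) (A : Euc m →L[ℝ] Euc n) (lam : ℝ) (hlam : 0 ≤ lam)
    (hA : A ∘L (ContinuousLinearMap.adjoint A)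
      = (lam ^ 2) • ContinuousLinearMap.id ℝ (Euc n))
    (u : Euc m → Euc n) (hu : ∀ x, u x = u₀ + A x)
    (f : Euc n → Euc ℓ) (hf : ContDiff ℝ (⊤ : ℕ∞) f) (x : Euc m) :
    divF (stress (f ∘ u)) x = lam ^ 4 • divF (stress f) (u x) := by
  have hu' : ∀ y, HasFDerivAt u A y := fun y => by
    rw [funext hu]
    exact A.hasFDerivAt.const_add u₀
  have hf2 : ContDiff ℝ 2 f := contDiff_infty.mp hf 2
  have hT := (differentiable_stress hf2 (u x)).hasFDerivAt
  have hs : stress (f ∘ u) = lam ^ 2 • fun y => (stress f ∘ u) y ∘L A := funext fun y =>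
    stress_comp hA (hu' y) (hf2.differentiable (by norm_num) (u y))
  have hd := ((hT.comp x (hu' x)).clm_comp (hasFDerivAt_const A x)).const_smul (lam ^ 2)
  rw [divF_eq_sum hT, hs, divF_eq_sum hd]
  have key := sum_bilinear_comp_of_comp_adjoint hA (fderiv ℝ (stress f) (u x))
  rw [show lam ^ 4 = lam ^ 2 * lam ^ 2 by ring, mul_smul, ← key, Finset.smul_sum]
  simp
end
end

section
/- Let n ≥ 1, let Λ be the set of multi-indices α ∈ ℕ^n with |α| ≤ 2, and let N = (n+1)(n+2)/2 = card Λ. Let F : ℝ^n × ℝ^Λ → ℝ be a smooth function and p₀ ∈ ℝ^Λ such that (i) F(0, p₀) = 0, and (ii) the linearized operator is elliptic at (0, p₀): for every ξ ∈ ℝ^n with ξ ≠ 0, Σ_{|α|=2} (∂F/∂u^{(α)})(0, p₀) ξ^α ≠ 0. Then there exist an open neighborhood U of 0 in ℝ^n and a smooth function u : U → ℝ such that F(x, (∂^α u(x))_{α∈Λ}) = 0 for all x ∈ U and ∂^α u(0) = p₀(α) for every α ∈ Λ. -/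
noncomputable section

/-- The set `Λ` of multi-indices `α ∈ ℕ^n` with `|α| ≤ 2`. -/
abbrev MI (n : ℕ) : Type := {α : Fin n → ℕ // ∑ i, α i ≤ 2}

instance MI.fintype (n : ℕ) : Fintype (MI n) := by
  have hb : ∀ (α : MI n) (i : Fin n), α.1 i ≤ 2 := fun α i =>
    le_trans (Finset.single_le_sum (f := α.1) (fun j _ => Nat.zero_le _)
      (Finset.mem_univ i)) α.2
  have : Finite (MI n) := by
    apply Finite.of_injective
      (fun α : MI n => fun i => (⟨α.1 i, Nat.lt_succ_of_le (hb α i)⟩ : Fin 3))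
    intro α β h
    refine Subtype.ext (funext fun i => ?_)
    simpa [Fin.ext_iff] using congrFun h i
  exact Fintype.ofFinite _

/-- The single partial derivative `∂_i f`. -/
def pd {n : ℕ} (i : Fin n) (f : Euc n → ℝ) : Euc n → ℝ :=
  fun x => fderiv ℝ f x (EuclideanSpace.single i (1 : ℝ))

/-- The multi-index partial derivative `∂^α f = ∂_1^{α 1} ⋯ ∂_n^{α n} f`. -/
def mderiv {n : ℕ} (α : Fin n → ℕ) : (Euc n → ℝ) → (Euc n → ℝ) :=
  (List.ofFn (fun i : Fin n => (pd i)^[α i])).foldr (· ∘ ·) id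

section

open scoped ENNReal ContDiff Topology
open Filter Set MeasureTheory

/-- The bounded `1/2`-Hölder functions `E → V`, as a closed subspace of `ℓ^∞(E × E, V)`: the
function `f` is stored as its values on the diagonal together with its Hölder quotients. -/
def holderSubmodule (E V : Type) [NormedAddCommGroup E] [NormedAddCommGroup V] [NormedSpace ℝ V] :
    Submodule ℝ (lp (fun _ : E × E => V) ∞) where
  carrier := {g | ∀ x y : E, g (x, x) - g (y, y) = √‖x - y‖ • g (x, y)}
  zero_mem' := by intro x y; simp
  add_mem' := by
    intro f g hf hg x y
    have h1 := hf x y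
    have h2 := hg x y
    simp only [lp.coeFn_add, Pi.add_apply, smul_add, ← h1, ← h2]
    abel
  smul_mem' := by
    intro c f hf x y
    have h1 := hf x y
    simp only [lp.coeFn_smul, Pi.smul_apply, ← smul_sub, h1, smul_comm c]

/-- The Banach space of bounded `1/2`-Hölder functions `E → V`. -/
def Hol (E V : Type) [NormedAddCommGroup E] [NormedAddCommGroup V] [NormedSpace ℝ V] : Type :=
  holderSubmodule E V

namespace Hol

section basic

variable {E V W : Type} [NormedAddCommGroup E] [NormedAddCommGroup V] [NormedSpace ℝ V]
  [NormedAddCommGroup W] [NormedSpace ℝ W]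

instance : NormedAddCommGroup (Hol E V) := inferInstanceAs (NormedAddCommGroup (holderSubmodule E V))
instance : NormedSpace ℝ (Hol E V) := inferInstanceAs (NormedSpace ℝ (holderSubmodule E V))

instance [CompleteSpace V] : CompleteSpace (Hol E V) := by
  have hc : IsClosed (holderSubmodule E V : Set (lp (fun _ : E × E => V) ∞)) := by
    have he : ∀ p : E × E, Continuous fun g : lp (fun _ : E × E => V) ∞ => g p := fun p =>
      (lp.lipschitzWith_one_eval ∞ p).continuous
    have : (holderSubmodule E V : Set (lp (fun _ : E × E => V) ∞)) =
        ⋂ x : E, ⋂ y : E, {g | g (x, x) - g (y, y) = √‖x - y‖ • g (x, y)} := by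
      ext g
      simp only [mem_iInter, mem_ofPred_eq]
      rfl
    rw [this]
    exact isClosed_iInter fun x => isClosed_iInter fun y =>
      isClosed_eq ((he _).sub (he _)) ((he _).const_smul _)
  exact hc.completeSpace_coe

/-- The underlying function. -/
def toFun (f : Hol E V) (x : E) : V := f.1 (x, x)

instance : CoeFun (Hol E V) fun _ => E → V := ⟨toFun⟩

@[simp] lemma add_apply (f g : Hol E V) (x : E) : (f + g) x = f x + g x := rfl
@[simp] lemma sub_apply (f g : Hol E V) (x : E) : (f - g) x = f x - g x := rfl
@[simp] lemma neg_apply (f : Hol E V) (x : E) : (-f) x = -f x := rfl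
@[simp] lemma zero_apply (x : E) : (0 : Hol E V) x = 0 := rfl
@[simp] lemma smul_apply (c : ℝ) (f : Hol E V) (x : E) : (c • f) x = c • f x := rfl

lemma norm_apply_le (f : Hol E V) (x : E) : ‖f x‖ ≤ ‖f‖ :=
  lp.norm_apply_le_norm ENNReal.top_ne_zero f.1 (x, x)

lemma norm_sub_le (f : Hol E V) (x y : E) : ‖f x - f y‖ ≤ ‖f‖ * √‖x - y‖ := by
  have h : f x - f y = √‖x - y‖ • f.1 (x, y) := f.2 x y
  rw [h, norm_smul, mul_comm, Real.norm_of_nonneg (Real.sqrt_nonneg _)]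
  exact mul_le_mul_of_nonneg_right (lp.norm_apply_le_norm ENNReal.top_ne_zero f.1 (x, y))
    (Real.sqrt_nonneg _)

lemma coe_offDiag (f : Hol E V) {x y : E} (h : x ≠ y) :
    f.1 (x, y) = (√‖x - y‖)⁻¹ • (f x - f y) := by
  have h' : f x - f y = √‖x - y‖ • f.1 (x, y) := f.2 x y
  have : √‖x - y‖ ≠ 0 := (Real.sqrt_pos.2 (norm_pos_iff.2 (sub_ne_zero.2 h))).ne'
  rw [h', smul_smul, inv_mul_cancel₀ this, one_smul]

@[ext] lemma ext {f g : Hol E V} (h : ∀ x, f x = g x) : f = g := by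
  refine Subtype.ext (lp.ext (funext ?_))
  rintro ⟨x, y⟩
  by_cases hxy : x = y
  · subst hxy; exact h x
  · rw [coe_offDiag f hxy, coe_offDiag g hxy, h, h]

lemma norm_le {f : Hol E V} {C : ℝ} (h1 : ∀ x, ‖f x‖ ≤ C)
    (h2 : ∀ x y, ‖f x - f y‖ ≤ C * √‖x - y‖) : ‖f‖ ≤ C := by
  refine lp.norm_le_of_forall_le (f := f.1) ((norm_nonneg _).trans (h1 0)) ?_
  rintro ⟨x, y⟩
  by_cases hxy : x = y
  · subst hxy; exact h1 x
  · have : 0 < √‖x - y‖ := Real.sqrt_pos.2 (norm_pos_iff.2 (sub_ne_zero.2 hxy))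
    rw [coe_offDiag f hxy, norm_smul, norm_inv, Real.norm_of_nonneg this.le, inv_mul_le_iff₀ this,
      mul_comm]
    exact h2 x y

open Classical in
/-- Constructor from explicit bounds. -/
def mk (f : E → V) (C : ℝ) (h1 : ∀ x, ‖f x‖ ≤ C) (h2 : ∀ x y, ‖f x - f y‖ ≤ C * √‖x - y‖) :
    Hol E V :=
  ⟨⟨fun p => if p.1 = p.2 then f p.1 else (√‖p.1 - p.2‖)⁻¹ • (f p.1 - f p.2), by
    refine memℓp_infty ⟨C, ?_⟩
    rintro _ ⟨⟨x, y⟩, rfl⟩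
    dsimp only
    split_ifs with hxy
    · exact h1 x
    · have : 0 < √‖x - y‖ := Real.sqrt_pos.2 (norm_pos_iff.2 (sub_ne_zero.2 hxy))
      rw [norm_smul, norm_inv, Real.norm_of_nonneg this.le, inv_mul_le_iff₀ this, mul_comm]
      exact h2 x y⟩, by
    intro x y
    dsimp only
    rw [if_pos rfl, if_pos rfl]
    split_ifs with hxy
    · subst hxy; simp
    · have : √‖x - y‖ ≠ 0 := (Real.sqrt_pos.2 (norm_pos_iff.2 (sub_ne_zero.2 hxy))).ne'
      rw [smul_smul, mul_inv_cancel₀ this, one_smul]⟩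

@[simp] lemma mk_apply (f : E → V) (C : ℝ) (h1 h2) (x : E) : (mk f C h1 h2) x = f x := by
  simp [mk, toFun]

lemma continuous (f : Hol E V) : Continuous f := by
  rw [continuous_iff_continuousAt]
  intro x
  rw [ContinuousAt, tendsto_iff_norm_sub_tendsto_zero]
  refine squeeze_zero (fun _ => norm_nonneg _) (fun y => norm_sub_le f y x) ?_
  have : Continuous fun y : E => ‖f‖ * √‖y - x‖ := by fun_prop
  simpa using this.tendsto x

/-- Constructor for continuous linear maps into `Hol E V`. -/
def mkCLM {X : Type*} [NormedAddCommGroup X] [NormedSpace ℝ X] (T : X → E → V) (C : ℝ)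
    (hadd : ∀ u v x, T (u + v) x = T u x + T v x) (hsmul : ∀ (c : ℝ) u x, T (c • u) x = c • T u x)
    (h1 : ∀ u x, ‖T u x‖ ≤ C * ‖u‖) (h2 : ∀ u x y, ‖T u x - T u y‖ ≤ C * ‖u‖ * √‖x - y‖) :
    X →L[ℝ] Hol E V :=
  LinearMap.mkContinuous
    { toFun := fun u => mk (T u) (C * ‖u‖) (h1 u) (h2 u)
      map_add' := fun u v => by ext x; simp [hadd]
      map_smul' := fun c u => by ext x; simp [hsmul] } C
    (fun u => norm_le (by intro x; simpa using h1 u x) (by intro x y; simpa using h2 u x y))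

@[simp] lemma mkCLM_apply {X : Type*} [NormedAddCommGroup X] [NormedSpace ℝ X] (T : X → E → V)
    (C : ℝ) (hadd hsmul h1 h2) (u : X) (x : E) :
    mkCLM T C hadd hsmul h1 h2 u x = T u x := by
  simp [mkCLM]

/-- Evaluation at a point. -/
def eval (x : E) : Hol E V →L[ℝ] V :=
  LinearMap.mkContinuous
    { toFun := fun f => f x, map_add' := fun _ _ => rfl, map_smul' := fun _ _ => rfl } 1
    (fun f => by rw [one_mul]; exact norm_apply_le f x)

@[simp] lemma eval_apply (x : E) (f : Hol E V) : eval x f = f x := rfl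

/-- Constant functions. -/
def const : V →L[ℝ] Hol E V :=
  mkCLM (fun v _ => v) 1 (fun _ _ _ => rfl) (fun _ _ _ => rfl) (by simp) (by
    intro u x y; simp only [sub_self, norm_zero]; positivity)

@[simp] lemma const_apply (v : V) (x : E) : const v x = v := by simp [const]

/-- Post-composition with a continuous linear map. -/
def postcomp (L : V →L[ℝ] W) : Hol E V →L[ℝ] Hol E W :=
  mkCLM (fun f x => L (f x)) ‖L‖ (by simp) (by simp)
    (fun f x => (L.le_opNorm _).trans (by gcongr; exact norm_apply_le f x))
    (fun f x y => by
      rw [← map_sub, mul_assoc]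
      exact (L.le_opNorm _).trans (by gcongr; exact norm_sub_le f x y))

@[simp] lemma postcomp_apply (L : V →L[ℝ] W) (f : Hol E V) (x : E) : postcomp L f x = L (f x) := by
  simp [postcomp]

/-- Translation of functions. -/
def translate (t : E) : Hol E V →L[ℝ] Hol E V :=
  mkCLM (fun f x => f (x + t)) 1 (by simp) (by simp)
    (fun f x => by simpa using norm_apply_le f (x + t))
    (fun f x y => by simpa using norm_sub_le f (x + t) (y + t))

@[simp] lemma translate_apply (t : E) (f : Hol E V) (x : E) : translate t f x = f (x + t) :=
  mkCLM_apply ..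

lemma norm_translate_le (t : E) (f : Hol E V) : ‖translate t f‖ ≤ ‖f‖ :=
  norm_le (fun x => by simpa using norm_apply_le f (x + t))
    (fun x y => by simpa using norm_sub_le f (x + t) (y + t))

variable {V₁ V₂ : Type} [NormedAddCommGroup V₁] [NormedSpace ℝ V₁]
  [NormedAddCommGroup V₂] [NormedSpace ℝ V₂]

/-- Pointwise application of a continuous bilinear map. -/
def bilin (B : V₁ →L[ℝ] V₂ →L[ℝ] W) : Hol E V₁ →L[ℝ] Hol E V₂ →L[ℝ] Hol E W :=
  have h0 : ∀ (f : Hol E V₁) (g : Hol E V₂) (x : E), ‖B (f x) (g x)‖ ≤ ‖B‖ * ‖f‖ * ‖g‖ :=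
    fun f g x => (B.le_opNorm₂ _ _).trans (by
      gcongr
      · exact norm_apply_le f x
      · exact norm_apply_le g x)
  have h1 : ∀ (f : Hol E V₁) (g : Hol E V₂) (x : E),
      ‖B (f x) (g x)‖ ≤ 2 * ‖B‖ * ‖f‖ * ‖g‖ := fun f g x => (h0 f g x).trans (by
    have : 0 ≤ ‖B‖ * ‖f‖ * ‖g‖ := by positivity
    linarith)
  have h2 : ∀ (f : Hol E V₁) (g : Hol E V₂) (x y : E),
      ‖B (f x) (g x) - B (f y) (g y)‖ ≤ 2 * ‖B‖ * ‖f‖ * ‖g‖ * √‖x - y‖ := fun f g x y => by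
    have e : B (f x) (g x) - B (f y) (g y) = B (f x - f y) (g x) + B (f y) (g x - g y) := by
      simp
    rw [e]
    calc _ ≤ ‖B‖ * ‖f x - f y‖ * ‖g x‖ + ‖B‖ * ‖f y‖ * ‖g x - g y‖ :=
          (norm_add_le _ _).trans (add_le_add (B.le_opNorm₂ _ _) (B.le_opNorm₂ _ _))
      _ ≤ ‖B‖ * (‖f‖ * √‖x - y‖) * ‖g‖ + ‖B‖ * ‖f‖ * (‖g‖ * √‖x - y‖) := by
          gcongr
          · exact norm_sub_le f x y
          · exact norm_apply_le g x
          · exact norm_apply_le f y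
          · exact norm_sub_le g x y
      _ = _ := by ring
  LinearMap.mkContinuous₂
    (LinearMap.mk₂ ℝ (fun f g => mk (fun x => B (f x) (g x)) _ (h1 f g) (h2 f g))
      (fun _ _ _ => by ext; simp) (fun _ _ _ => by ext; simp)
      (fun _ _ _ => by ext; simp) (fun _ _ _ => by ext; simp)) (2 * ‖B‖)
    (fun f g => norm_le (fun x => by simpa using h1 f g x) (fun x y => by simpa using h2 f g x y))

@[simp] lemma bilin_apply (B : V₁ →L[ℝ] V₂ →L[ℝ] W) (f : Hol E V₁) (g : Hol E V₂) (x : E) :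
    bilin B f g x = B (f x) (g x) := by
  simp [bilin]

end basic

section superposition

variable {E V W : Type} [NormedAddCommGroup E] [NormedAddCommGroup V] [NormedSpace ℝ V]
  [NormedAddCommGroup W]

lemma exists_bound_closedBall [FiniteDimensional ℝ V] {F : V → W} (hF : Continuous F) (R : ℝ) :
    ∃ C, 0 ≤ C ∧ ∀ a, ‖a‖ ≤ R → ‖F a‖ ≤ C := by
  have := FiniteDimensional.proper ℝ V
  obtain ⟨C, hC⟩ := (isCompact_closedBall (0 : V) R).exists_bound_of_continuousOn hF.continuousOn
  exact ⟨max C 0, le_max_right _ _, fun a ha => (hC a (by simpa using ha)).trans (le_max_left _ _)⟩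

variable [NormedSpace ℝ W]

lemma exists_lipschitz_closedBall [FiniteDimensional ℝ V] {F : V → W} (hF : ContDiff ℝ 1 F)
    (R : ℝ) : ∃ C, 0 ≤ C ∧ ∀ a b, ‖a‖ ≤ R → ‖b‖ ≤ R → ‖F a - F b‖ ≤ C * ‖a - b‖ := by
  obtain ⟨C, hC0, hC⟩ := exists_bound_closedBall (hF.continuous_fderiv one_ne_zero) R
  refine ⟨C, hC0, fun a b ha hb => ?_⟩
  refine (convex_closedBall (0 : V) R).norm_image_sub_le_of_norm_fderiv_le (𝕜 := ℝ)
    (fun x _ => (hF.differentiable one_ne_zero) x) (fun x hx => hC x (by simpa using hx))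
    (by simpa using hb) (by simpa using ha)

open Classical in
/-- The superposition operator `f ↦ F ∘ f`. -/
def comp (F : V → W) (f : Hol E V) : Hol E W :=
  if h : ∃ C, (∀ x, ‖F (f x)‖ ≤ C) ∧ ∀ x y, ‖F (f x) - F (f y)‖ ≤ C * √‖x - y‖ then
    mk (fun x => F (f x)) h.choose h.choose_spec.1 h.choose_spec.2
  else 0

lemma comp_apply [FiniteDimensional ℝ V] {F : V → W} (hF : ContDiff ℝ 1 F) (f : Hol E V) (x : E) :
    comp F f x = F (f x) := by
  have h : ∃ C, (∀ x, ‖F (f x)‖ ≤ C) ∧ ∀ x y, ‖F (f x) - F (f y)‖ ≤ C * √‖x - y‖ := by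
    obtain ⟨C₁, h₁, hC₁⟩ := exists_bound_closedBall hF.continuous ‖f‖
    obtain ⟨C₂, h₂, hC₂⟩ := exists_lipschitz_closedBall hF ‖f‖
    refine ⟨C₁ + C₂ * ‖f‖, fun x => (hC₁ _ (norm_apply_le f x)).trans ?_, fun x y => ?_⟩
    · have := mul_nonneg h₂ (norm_nonneg f); linarith
    · calc _ ≤ C₂ * ‖f x - f y‖ := hC₂ _ _ (norm_apply_le f x) (norm_apply_le f y)
        _ ≤ C₂ * (‖f‖ * √‖x - y‖) := by gcongr; exact norm_sub_le f x y
        _ ≤ _ := by have := mul_nonneg h₁ (Real.sqrt_nonneg ‖x - y‖); linarith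
  rw [comp, dif_pos h, mk_apply]

lemma norm_taylor_sub_le {G : V → W} (hG : ContDiff ℝ 1 G) {R M δ : ℝ} (hM : 0 ≤ M)
    (hL : ∀ a b, ‖a‖ ≤ R → ‖b‖ ≤ R → ‖fderiv ℝ G a - fderiv ℝ G b‖ ≤ M * ‖a - b‖)
    {a b c : V} (ha : ‖a‖ + δ ≤ R) (hb : ‖b‖ ≤ δ) (hc : ‖c‖ ≤ δ) :
    ‖(G (a + b) - fderiv ℝ G a b) - (G (a + c) - fderiv ℝ G a c)‖ ≤ M * δ * ‖b - c‖ := by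
  have hδ : 0 ≤ δ := (norm_nonneg _).trans hb
  have hd : ∀ x, HasFDerivAt (fun b => G (a + b) - fderiv ℝ G a b)
      (fderiv ℝ G (a + x) - fderiv ℝ G a) x := fun x => by
    have h1 : HasFDerivAt (fun b => G (a + b)) (fderiv ℝ G (a + x)) x :=
      (hasFDerivAt_comp_add_left a).2 (hG.differentiable one_ne_zero (a + x)).hasFDerivAt
    exact h1.sub (fderiv ℝ G a).hasFDerivAt
  refine (convex_closedBall (0 : V) δ).norm_image_sub_le_of_norm_hasFDerivWithin_le (𝕜 := ℝ)
    (fun x _ => (hd x).hasFDerivWithinAt) (fun x hx => ?_) (by simpa using hc) (by simpa using hb)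
  have hx' : ‖x‖ ≤ δ := by simpa using hx
  refine (hL _ _ ((norm_add_le _ _).trans (by linarith)) (by linarith)).trans ?_
  simpa using mul_le_mul_of_nonneg_left hx' hM

/-- The operator `f ↦ F ∘ f` is differentiable with derivative `h ↦ (DF ∘ f) h`. -/
lemma hasFDerivAt_comp [FiniteDimensional ℝ V] {F : V → W} (hF : ContDiff ℝ ∞ F) (f : Hol E V) :
    HasFDerivAt (comp F : Hol E V → Hol E W)
      (bilin (ContinuousLinearMap.id ℝ (V →L[ℝ] W)) (comp (fderiv ℝ F) f)) f := by
  have hF1 : ContDiff ℝ 1 F := hF.of_le (by exact_mod_cast le_top)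
  have hDF : ContDiff ℝ ∞ (fderiv ℝ F) := hF.fderiv_right (by simp)
  have hDF1 : ContDiff ℝ 1 (fderiv ℝ F) := hDF.of_le (by exact_mod_cast le_top)
  have hDDF1 : ContDiff ℝ 1 (fderiv ℝ (fderiv ℝ F)) :=
    (hDF.fderiv_right (m := ∞) (by simp)).of_le (by exact_mod_cast le_top)
  obtain ⟨M₁, hM₁, hL₁⟩ := exists_lipschitz_closedBall hDF1 (‖f‖ + 1)
  obtain ⟨M₂, hM₂, hL₂⟩ := exists_lipschitz_closedBall hDDF1 (‖f‖ + 1)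
  rw [hasFDerivAt_iff_isLittleO_nhds_zero]
  have key : ∀ h : Hol E V, ‖h‖ ≤ 1 → ‖comp F (f + h) - comp F f -
      bilin (ContinuousLinearMap.id ℝ (V →L[ℝ] W)) (comp (fderiv ℝ F) f) h‖ ≤
      (M₁ + M₂ * ‖f‖) * ‖h‖ ^ 2 := by
    intro h hh
    have hval : ∀ x, (comp F (f + h) - comp F f -
        bilin (ContinuousLinearMap.id ℝ (V →L[ℝ] W)) (comp (fderiv ℝ F) f) h) x =
        F (f x + h x) - F (f x) - fderiv ℝ F (f x) (h x) := fun x => by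
      simp [comp_apply hF1, comp_apply hDF1]
    have hfx : ∀ x, ‖f x‖ + ‖h‖ ≤ ‖f‖ + 1 := fun x => add_le_add (norm_apply_le f x) hh
    refine norm_le (fun x => ?_) (fun x y => ?_)
    · rw [hval]
      have := norm_taylor_sub_le hF1 hM₁ hL₁ (hfx x) (norm_apply_le h x)
        (c := 0) (by simp)
      simp only [add_zero, map_zero, sub_zero] at this
      rw [sub_right_comm]
      calc _ ≤ M₁ * ‖h‖ * ‖h x‖ := this
        _ ≤ M₁ * ‖h‖ * ‖h‖ := by gcongr; exact norm_apply_le h x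
        _ ≤ _ := by
          have : 0 ≤ M₂ * ‖f‖ * ‖h‖ ^ 2 := by positivity
          nlinarith
    · rw [hval, hval]
      have t1 := norm_taylor_sub_le hF1 hM₁ hL₁ (hfx x) (norm_apply_le h x) (norm_apply_le h y)
      have t2 : ‖(F (f x + h y) - F (f x) - fderiv ℝ F (f x) (h y)) -
          (F (f y + h y) - F (f y) - fderiv ℝ F (f y) (h y))‖ ≤ M₂ * ‖h‖ * ‖h‖ * ‖f x - f y‖ := by
        have hd : ∀ a, HasFDerivAt (fun a => F (a + h y) - F a - fderiv ℝ F a (h y))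
            (fderiv ℝ F (a + h y) - fderiv ℝ F a - fderiv ℝ (fderiv ℝ F) a (h y)) a := fun a => by
          have h1 : HasFDerivAt (fun a => F (a + h y)) (fderiv ℝ F (a + h y)) a :=
            (hasFDerivAt_comp_add_right (h y)).2 (hF1.differentiable one_ne_zero (a + h y)).hasFDerivAt
          have h2 : HasFDerivAt F (fderiv ℝ F a) a := (hF1.differentiable one_ne_zero a).hasFDerivAt
          have h3 : HasFDerivAt (fun a => fderiv ℝ F a (h y))
              (fderiv ℝ (fderiv ℝ F) a (h y)) a := by
            have h4 := ((hDF1.differentiable one_ne_zero a).hasFDerivAt).clm_apply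
              (hasFDerivAt_const (h y) a)
            convert h4 using 1
            ext v
            have hs : IsSymmSndFDerivAt ℝ F a :=
              (hF.contDiffAt (x := a)).isSymmSndFDerivAt
                (by simp only [minSmoothness_of_isRCLikeNormedField]; exact WithTop.coe_le_coe.2 le_top)
            simpa using hs (h y) v
          exact (h1.sub h2).sub h3
        refine (convex_closedBall (0 : V) ‖f‖).norm_image_sub_le_of_norm_hasFDerivWithin_le
          (𝕜 := ℝ) (fun a _ => (hd a).hasFDerivWithinAt) (fun a ha => ?_)
          (by simpa using norm_apply_le f y) (by simpa using norm_apply_le f x)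
        have ha' : ‖a‖ + ‖h‖ ≤ ‖f‖ + 1 := add_le_add (by simpa using ha) hh
        have := norm_taylor_sub_le hDF1 hM₂ hL₂ ha' (norm_apply_le h y) (c := 0) (by simp)
        simp only [add_zero, map_zero, sub_zero] at this
        rw [sub_right_comm]
        exact this.trans (by gcongr; exact norm_apply_le h y)
      calc _ = ‖((F (f x + h x) - fderiv ℝ F (f x) (h x)) -
            (F (f x + h y) - fderiv ℝ F (f x) (h y))) +
            ((F (f x + h y) - F (f x) - fderiv ℝ F (f x) (h y)) -
            (F (f y + h y) - F (f y) - fderiv ℝ F (f y) (h y)))‖ := by congr 1; abel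
        _ ≤ M₁ * ‖h‖ * ‖h x - h y‖ + M₂ * ‖h‖ * ‖h‖ * ‖f x - f y‖ :=
          (norm_add_le _ _).trans (add_le_add t1 t2)
        _ ≤ M₁ * ‖h‖ * (‖h‖ * √‖x - y‖) + M₂ * ‖h‖ * ‖h‖ * (‖f‖ * √‖x - y‖) := by
          gcongr
          · exact norm_sub_le h x y
          · exact norm_sub_le f x y
        _ = _ := by ring
  have hO : (fun h : Hol E V => comp F (f + h) - comp F f -
      bilin (ContinuousLinearMap.id ℝ (V →L[ℝ] W)) (comp (fderiv ℝ F) f) h) =O[𝓝 0]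
      fun h => ‖h‖ ^ 2 := by
    refine Asymptotics.IsBigO.of_bound (M₁ + M₂ * ‖f‖) ?_
    filter_upwards [Metric.closedBall_mem_nhds (0 : Hol E V) one_pos] with h hh
    simpa using key h (by simpa using hh)
  refine hO.trans_isLittleO ?_
  have := Asymptotics.isLittleO_norm_pow_id (E' := Hol E V) one_lt_two
  exact this

/-- The superposition operator of a smooth function is smooth. -/
theorem contDiff_comp [FiniteDimensional ℝ V] {F : V → W} (hF : ContDiff ℝ ∞ F) :
    ContDiff ℝ ∞ (comp F : Hol E V → Hol E W) := by
  rw [contDiff_infty]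
  intro n
  induction n generalizing W with
  | zero =>
    rw [Nat.cast_zero, contDiff_zero]
    exact continuous_iff_continuousAt.2 fun f => (hasFDerivAt_comp hF f).continuousAt
  | succ n ih =>
    rw [Nat.cast_add, Nat.cast_one, contDiff_succ_iff_hasFDerivAt]
    exact ⟨_, (bilin (ContinuousLinearMap.id ℝ (V →L[ℝ] W))).contDiff.comp
      (ih (hF.fderiv_right (by simp))), fun f => hasFDerivAt_comp hF f⟩

end superposition

section mollify

set_option linter.unusedSectionVars false

variable {E V W : Type} [NormedAddCommGroup E] [InnerProductSpace ℝ E] [FiniteDimensional ℝ E]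
  [MeasurableSpace E] [BorelSpace E] [NormedAddCommGroup V] [NormedSpace ℝ V]
  [NormedAddCommGroup W] [NormedSpace ℝ W]

omit [InnerProductSpace ℝ E] [FiniteDimensional ℝ E] [BorelSpace E] in
lemma integral_clm_add {X : Type} [NormedAddCommGroup X] [NormedSpace ℝ X] [CompleteSpace V]
    [CompleteSpace W] [CompleteSpace X] {μ : Measure E} (T₁ : V →L[ℝ] X) (T₂ : W →L[ℝ] X)
    {a : E → V} {b : E → W} (ha : Integrable a μ) (hb : Integrable b μ) :
    ∫ z, (T₁ (a z) + T₂ (b z)) ∂μ = T₁ (∫ z, a z ∂μ) + T₂ (∫ z, b z ∂μ) := by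
  rw [integral_add (T₁.integrable_comp ha) (T₂.integrable_comp hb), T₁.integral_comp_comm ha,
    T₂.integral_comp_comm hb]

/-- The mollification of `f` at scale `s` by the kernel `φ`. -/
def mollify (φ : E → V) (f : Hol E ℝ) (s : ℝ) (x : E) : V := ∫ z, f (x - s • z) • φ z

/-- Kernels that are continuous with compact support. -/
structure IsKernel (φ : E → V) : Prop where
  smooth : ContDiff ℝ ∞ φ
  supp : HasCompactSupport φ

namespace IsKernel

lemma fderiv {φ : E → V} (h : IsKernel φ) : IsKernel (fderiv ℝ φ) :=
  ⟨h.smooth.fderiv_right (by simp), h.supp.fderiv ℝ⟩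

lemma integrable_smul {φ : E → V} (h : IsKernel φ) {g : E → ℝ} (hg : Continuous g) :
    Integrable (fun z => g z • φ z) :=
  (hg.smul h.smooth.continuous).integrable_of_hasCompactSupport h.supp.smul_left

lemma integrable {φ : E → V} (h : IsKernel φ) : Integrable φ :=
  h.smooth.continuous.integrable_of_hasCompactSupport h.supp

/-- A constant controlling all the operators attached to a kernel. -/
def mass (φ : E → V) : ℝ := ∫ z, (1 + √‖z‖) * ‖φ z‖

lemma mass_nonneg (φ : E → V) : 0 ≤ mass φ := integral_nonneg fun z => by positivity

lemma integrable_mass {φ : E → V} (h : IsKernel φ) : Integrable fun z => (1 + √‖z‖) * ‖φ z‖ := by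
  have : Continuous fun z : E => (1 + √‖z‖) := by fun_prop
  refine (this.mul h.smooth.continuous.norm).integrable_of_hasCompactSupport ?_
  exact h.supp.norm.mul_left

variable {φ : E → V}

lemma integrable_mollify (h : IsKernel φ) (f : Hol E ℝ) (s : ℝ) (x : E) :
    Integrable (fun z => f (x - s • z) • φ z) :=
  h.integrable_smul (f.continuous.comp (by fun_prop))

lemma mollify_add (h : IsKernel φ) (f g : Hol E ℝ) (s : ℝ) (x : E) :
    mollify φ (f + g) s x = mollify φ f s x + mollify φ g s x := by
  simp only [mollify, add_apply, add_smul]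
  exact integral_add (h.integrable_mollify f s x) (h.integrable_mollify g s x)

lemma mollify_smul (φ : E → V) (c : ℝ) (f : Hol E ℝ) (s : ℝ) (x : E) :
    mollify φ (c • f) s x = c • mollify φ f s x := by
  simp only [mollify, smul_apply, smul_assoc, integral_smul]

lemma mollify_translate (φ : E → V) (t : E) (f : Hol E ℝ) (s : ℝ) (x : E) :
    mollify φ (translate t f) s x = mollify φ f s (x + t) := by
  simp only [mollify, translate_apply, sub_add_eq_add_sub]

lemma mollify_comp_clm [CompleteSpace V] [CompleteSpace W] (h : IsKernel φ) (L : V →L[ℝ] W)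
    (f : Hol E ℝ) (s : ℝ) (x : E) :
    mollify (fun z => L (φ z)) f s x = L (mollify φ f s x) := by
  simp only [mollify, ← map_smul]
  exact L.integral_comp_comm (h.integrable_mollify f s x)

lemma norm_mollify_le (h : IsKernel φ) (f : Hol E ℝ) (s : ℝ) (x : E) :
    ‖mollify φ f s x‖ ≤ mass φ * ‖f‖ := by
  rw [mass, mul_comm, ← integral_const_mul]
  refine norm_integral_le_of_norm_le (h.integrable_mass.const_mul _) (Eventually.of_forall ?_)
  intro z
  rw [norm_smul]
  have h1 := norm_apply_le f (x - s • z)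
  have h2 : 0 ≤ √‖z‖ * ‖φ z‖ := by positivity
  have h3 := mul_le_mul_of_nonneg_right h1 (norm_nonneg (φ z))
  have h4 := mul_nonneg (norm_nonneg f) h2
  nlinarith

lemma norm_mollify_sub_le (h : IsKernel φ) (f : Hol E ℝ) (s : ℝ) (x y : E) :
    ‖mollify φ f s x - mollify φ f s y‖ ≤ mass φ * ‖f‖ * √‖x - y‖ := by
  have : mollify φ f s x - mollify φ f s y = ∫ z, (f (x - s • z) - f (y - s • z)) • φ z := by
    simp only [sub_smul]
    exact (integral_sub (h.integrable_mollify f s x) (h.integrable_mollify f s y)).symm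
  rw [this, mass, mul_assoc, mul_comm, ← integral_const_mul]
  refine norm_integral_le_of_norm_le (h.integrable_mass.const_mul _) (Eventually.of_forall ?_)
  intro z
  rw [norm_smul]
  have h1 := norm_sub_le f (x - s • z) (y - s • z)
  rw [sub_sub_sub_cancel_right] at h1
  have h2 : 0 ≤ √‖z‖ * ‖φ z‖ := by positivity
  have h3 := mul_le_mul_of_nonneg_right h1 (norm_nonneg (φ z))
  have h4 := mul_nonneg (mul_nonneg (norm_nonneg f) (Real.sqrt_nonneg ‖x - y‖)) h2
  nlinarith

lemma norm_mollify_le_of_integral_eq_zero [CompleteSpace V] (h : IsKernel φ) (h0 : ∫ z, φ z = 0) (f : Hol E ℝ)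
    {s : ℝ} (hs : 0 ≤ s) (x : E) :
    ‖mollify φ f s x‖ ≤ mass φ * ‖f‖ * √s := by
  have : mollify φ f s x = ∫ z, (f (x - s • z) - f x) • φ z := by
    simp only [sub_smul]
    have := integral_sub (h.integrable_mollify f s x) (h.integrable.smul (f x))
    simp only [Pi.smul_apply] at this
    rw [this, integral_smul, h0, smul_zero, sub_zero, mollify]
  rw [this, mass, mul_assoc, mul_comm, ← integral_const_mul]
  refine norm_integral_le_of_norm_le (h.integrable_mass.const_mul _) (Eventually.of_forall ?_)
  intro z
  rw [norm_smul]
  have h1 := norm_sub_le f (x - s • z) x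
  rw [sub_sub_cancel_left, norm_neg, norm_smul, Real.norm_of_nonneg hs, Real.sqrt_mul hs] at h1
  have h2 : 0 ≤ √‖z‖ * ‖φ z‖ := by positivity
  have h3 := mul_le_mul_of_nonneg_right h1 (norm_nonneg (φ z))
  have h4 : 0 ≤ ‖f‖ * √s * ‖φ z‖ := by positivity
  nlinarith

lemma continuous_mollify (h : IsKernel φ) (f : Hol E ℝ) :
    Continuous fun p : ℝ × E => mollify φ f p.1 p.2 := by
  refine continuous_of_dominated (bound := fun z => ‖f‖ * ‖φ z‖)
    (fun p => (h.integrable_mollify f p.1 p.2).aestronglyMeasurable)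
    (fun p => Eventually.of_forall fun z => ?_) (h.integrable.norm.const_mul _)
    (Eventually.of_forall fun z => ?_)
  · rw [norm_smul]
    exact mul_le_mul_of_nonneg_right (norm_apply_le f _) (norm_nonneg _)
  · exact (f.continuous.comp (by fun_prop)).smul continuous_const

lemma mollify_zero (φ : E → V) (f : Hol E ℝ) (x : E) :
    mollify φ f 0 x = f x • ∫ z, φ z := by
  simp [mollify, integral_smul]

end IsKernel

/-- The rescaled kernel. -/
def rescale (φ : E → V) (s : ℝ) (z : E) : V := (s ^ Module.finrank ℝ E)⁻¹ • φ (s⁻¹ • z)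

lemma mollify_eq_convolution (φ : E → V) (f : Hol E ℝ) {s : ℝ} (hs : 0 < s) (x : E) :
    mollify φ f s x = ∫ t, f t • rescale φ s (x - t) := by
  have h1 : mollify φ f s x = ∫ z, (fun w => f (x - w) • φ (s⁻¹ • w)) (s • z) := by
    simp only [mollify, smul_smul, inv_mul_cancel₀ hs.ne', one_smul]
  rw [h1, Measure.integral_comp_smul_of_nonneg volume
    (fun w => f (x - w) • φ (s⁻¹ • w)) s (hR := hs.le), ← integral_sub_left_eq_self _ _ x, ← integral_smul]
  refine integral_congr_ae (Eventually.of_forall fun t => ?_)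
  simp only [rescale, sub_sub_cancel]
  rw [smul_comm]

/-- The kernel describing the derivative of the mollification in the scale. -/
def scaleDeriv (φ : E → V) (z : E) : V :=
  -((Module.finrank ℝ E : ℝ) • φ z + fderiv ℝ φ z z)

namespace IsKernel

variable {φ : E → V}

lemma rescale (h : IsKernel φ) {s : ℝ} (hs : 0 < s) : IsKernel (rescale φ s) := by
  refine ⟨contDiff_const.smul (h.smooth.comp (contDiff_const.smul contDiff_id)), ?_⟩
  have : HasCompactSupport fun z => φ (s⁻¹ • z) := by
    exact h.supp.comp_homeomorph (Homeomorph.smulOfNeZero s⁻¹ (inv_ne_zero hs.ne'))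
  exact this.smul_left

lemma scaleDeriv (h : IsKernel φ) : IsKernel (scaleDeriv φ) := by
  refine ⟨((contDiff_const.smul h.smooth).add
    (h.fderiv.smooth.clm_apply contDiff_id)).neg, ?_⟩
  refine HasCompactSupport.neg (f := fun z => (Module.finrank ℝ E : ℝ) • φ z + _root_.fderiv ℝ φ z z) ?_
  refine HasCompactSupport.add h.supp.smul_left ?_
  refine (h.supp.fderiv ℝ).mono ?_
  intro z hz hz'
  simp [hz'] at hz

lemma hasFDerivAt_rescale (h : IsKernel φ) {s : ℝ} (hs : 0 < s) (z : E) :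
    HasFDerivAt (fun p : ℝ × E => Hol.rescale φ p.1 p.2)
      ((ContinuousLinearMap.fst ℝ ℝ E).smulRight (s⁻¹ • Hol.rescale (Hol.scaleDeriv φ) s z) +
        (s⁻¹ • Hol.rescale (_root_.fderiv ℝ φ) s z) ∘L ContinuousLinearMap.snd ℝ ℝ E) (s, z) := by
  have hf : HasFDerivAt (Prod.fst : ℝ × E → ℝ) (ContinuousLinearMap.fst ℝ ℝ E) (s, z) :=
    hasFDerivAt_fst
  have h1 : HasFDerivAt (fun p : ℝ × E => p.1⁻¹) (-(s ^ 2)⁻¹ • ContinuousLinearMap.fst ℝ ℝ E)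
      (s, z) := HasDerivAt.comp_hasFDerivAt (s, z) (hasDerivAt_inv hs.ne') hf
  have h2 : HasFDerivAt (fun p : ℝ × E => (p.1 ^ Module.finrank ℝ E)⁻¹)
      ((-((Module.finrank ℝ E : ℝ) * s ^ (Module.finrank ℝ E - 1)) / (s ^ Module.finrank ℝ E) ^ 2) •
        ContinuousLinearMap.fst ℝ ℝ E) (s, z) :=
    HasDerivAt.comp_hasFDerivAt (s, z) (h₂ := fun t : ℝ => (t ^ Module.finrank ℝ E)⁻¹)
      ((hasDerivAt_pow (Module.finrank ℝ E) s).fun_inv (by positivity)) hf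
  have h3 : HasFDerivAt (fun p : ℝ × E => p.1⁻¹ • p.2) _ (s, z) := h1.smul hasFDerivAt_snd
  have h4 : HasFDerivAt (fun p : ℝ × E => φ (p.1⁻¹ • p.2)) _ (s, z) :=
    ((h.smooth.differentiable (by simp)) (s⁻¹ • z)).hasFDerivAt.comp (s, z) h3
  have h5 := h2.smul h4
  refine h5.congr_fderiv ?_
  ext v
  · have e : ((Module.finrank ℝ E : ℝ) * s ^ (Module.finrank ℝ E - 1)) / (s ^ Module.finrank ℝ E) ^ 2
        = s⁻¹ * ((s ^ Module.finrank ℝ E)⁻¹ * Module.finrank ℝ E) := by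
      rcases Nat.eq_zero_or_pos (Module.finrank ℝ E) with h0 | h0
      · simp [h0]
      · obtain ⟨m, hm⟩ := Nat.exists_eq_succ_of_ne_zero h0.ne'
        rw [hm]
        simp only [Nat.succ_sub_one, pow_succ]
        field_simp
    simp [Hol.rescale, Hol.scaleDeriv, neg_div, e, smul_smul]
    congr 1
    ring
  · simp [Hol.rescale, smul_smul, mul_comm]

lemma hasFDerivAt_mollify [CompleteSpace V] (h : IsKernel φ) (f : Hol E ℝ) {s : ℝ} (hs : 0 < s)
    (x : E) : HasFDerivAt (fun p : ℝ × E => mollify φ f p.1 p.2)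
      ((ContinuousLinearMap.fst ℝ ℝ E).smulRight (s⁻¹ • mollify (Hol.scaleDeriv φ) f s x) +
        (s⁻¹ • mollify (_root_.fderiv ℝ φ) f s x) ∘L ContinuousLinearMap.snd ℝ ℝ E) (s, x) := by
  obtain ⟨R, hR⟩ := h.supp.isCompact.isBounded.subset_closedBall 0
  have hR0 : ∀ z, R < ‖z‖ → φ z = 0 := fun z hz => by
    by_contra h0
    have := hR (subset_tsupport φ h0)
    rw [mem_closedBall_zero_iff] at this
    linarith
  have hsm : ContDiffOn ℝ 1 (fun p : ℝ × E => Hol.rescale φ p.1 p.2) (Ioo 0 (2 * s) ×ˢ univ) := by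
    have hne : ∀ p ∈ (Ioo 0 (2 * s) ×ˢ univ : Set (ℝ × E)), p.1 ≠ 0 := fun p hp => hp.1.1.ne'
    refine ContDiffOn.smul (ContDiffOn.inv (contDiff_fst.pow _).contDiffOn
      fun p hp => pow_ne_zero _ (hne p hp)) ?_
    exact (h.smooth.of_le (by exact_mod_cast le_top)).comp_contDiffOn
      ((contDiff_fst.contDiffOn.inv hne).smul contDiff_snd.contDiffOn)
  have key := hasFDerivAt_convolution_right_with_param (μ := volume) (f := f)
    (ContinuousLinearMap.lsmul ℝ ℝ : ℝ →L[ℝ] V →L[ℝ] V) (g := Hol.rescale φ)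
    (s := Ioo 0 (2 * s)) (k := Metric.closedBall (0 : E) (2 * s * |R|)) isOpen_Ioo
    (isCompact_closedBall _ _) (fun p x hp hx => by
      rw [mem_closedBall_zero_iff, not_le] at hx
      rw [Hol.rescale, hR0, smul_zero]
      rw [norm_smul, norm_inv, Real.norm_of_nonneg hp.1.le, lt_inv_mul_iff₀ hp.1]
      have h1 := hp.2
      have h2 := hp.1
      nlinarith [le_abs_self R, abs_nonneg R])
    (f.continuous.locallyIntegrable) hsm (s, x) ⟨hs, by linarith⟩
  have hev : (fun p : ℝ × E => mollify φ f p.1 p.2) =ᶠ[𝓝 (s, x)] fun q : ℝ × E =>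
      convolution f (Hol.rescale φ q.1) (ContinuousLinearMap.lsmul ℝ ℝ) volume q.2 := by
    filter_upwards [(continuous_fst.tendsto (s, x)).eventually (lt_mem_nhds hs)] with p hp
    rw [mollify_eq_convolution φ f hp]
    rfl
  refine (key.congr_of_eventuallyEq hev).congr_fderiv ?_
  have e1 : ∀ z, _root_.fderiv ℝ (↿(Hol.rescale φ)) (s, z) = _ := fun z =>
    (h.hasFDerivAt_rescale hs z).fderiv
  have i1 := (h.scaleDeriv.rescale hs).integrable_mollify f 0 0
  have j1 : Integrable fun t => f t • Hol.rescale (Hol.scaleDeriv φ) s (x - t) := by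
    have := (h.scaleDeriv.rescale hs).integrable_smul (g := fun t => f (x - t))
      (f.continuous.comp (by fun_prop))
    simpa using this.comp_sub_left x
  have j2 : Integrable fun t => f t • Hol.rescale (_root_.fderiv ℝ φ) s (x - t) := by
    have := (h.fderiv.rescale hs).integrable_smul (g := fun t => f (x - t))
      (f.continuous.comp (by fun_prop))
    simpa using this.comp_sub_left x
  simp only [convolution, e1]
  rw [mollify_eq_convolution _ f hs, mollify_eq_convolution _ f hs]
  let T1 : V →L[ℝ] (ℝ × E →L[ℝ] V) :=
    s⁻¹ • ContinuousLinearMap.smulRightL ℝ (ℝ × E) V (ContinuousLinearMap.fst ℝ ℝ E)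
  let T2 : (E →L[ℝ] V) →L[ℝ] (ℝ × E →L[ℝ] V) :=
    s⁻¹ • (ContinuousLinearMap.compL ℝ (ℝ × E) E V).flip (ContinuousLinearMap.snd ℝ ℝ E)
  have e4 := integral_clm_add (X := ℝ × E →L[ℝ] V) T1 T2 j1 j2
  calc _ = ∫ a, (T1 (f a • Hol.rescale (Hol.scaleDeriv φ) s (x - a)) +
        T2 (f a • Hol.rescale (_root_.fderiv ℝ φ) s (x - a))) := by
        refine integral_congr_ae (Eventually.of_forall fun t => ?_)
        ext v <;> simp [T1, T2, ContinuousLinearMap.precompR, smul_smul, mul_comm]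
    _ = _ := by
      rw [e4]
      ext v <;> simp [T1, T2]

lemma hasFDerivAt_mollify_space [CompleteSpace V] (h : IsKernel φ) (f : Hol E ℝ) {s : ℝ}
    (hs : 0 < s) (x : E) :
    HasFDerivAt (mollify φ f s) (s⁻¹ • mollify (_root_.fderiv ℝ φ) f s x) x := by
  have h1 := (h.hasFDerivAt_mollify f hs x).comp x (hasFDerivAt_prodMk_right s x)
  refine h1.congr_fderiv ?_
  ext v
  simp

lemma hasDerivAt_mollify_scale [CompleteSpace V] (h : IsKernel φ) (f : Hol E ℝ) {s : ℝ}
    (hs : 0 < s) (x : E) :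
    HasDerivAt (fun s => mollify φ f s x) (s⁻¹ • mollify (Hol.scaleDeriv φ) f s x) s := by
  have h1 := HasFDerivAt.comp (𝕜 := ℝ) (f := fun s : ℝ => (s, x)) s (h.hasFDerivAt_mollify f hs x)
    (hasFDerivAt_prodMk_left s x)
  have := h1.hasDerivAt
  simpa [Function.comp_def] using this

lemma integral_fderiv [CompleteSpace V] (h : IsKernel φ) : ∫ z, _root_.fderiv ℝ φ z = 0 := by
  have h1 := h.hasFDerivAt_mollify_space (const (1 : ℝ)) one_pos 0
  have h2 : mollify φ (const (1 : ℝ)) 1 = fun _ => ∫ z, φ z := by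
    ext x; simp [mollify]
  rw [h2] at h1
  have := h1.unique (hasFDerivAt_const _ _)
  simpa [mollify] using this

end IsKernel
end mollify

section potential

set_option linter.unusedSectionVars false

variable {E V W : Type} [NormedAddCommGroup E] [InnerProductSpace ℝ E] [FiniteDimensional ℝ E]
  [MeasurableSpace E] [BorelSpace E] [NormedAddCommGroup V] [NormedSpace ℝ V]
  [NormedAddCommGroup W] [NormedSpace ℝ W]

/-- The superposition, with weight `w`, of the mollifications of `f` at the scales `s ≤ T`. -/
def potential (w : ℝ → ℝ) (φ : E → V) (T : ℝ) (f : Hol E ℝ) (x : E) : V :=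
  ∫ s in (0 : ℝ)..T, w s • mollify φ f s x

lemma potential_translate (w : ℝ → ℝ) (φ : E → V) (T : ℝ) (t : E) (f : Hol E ℝ) (x : E) :
    potential w φ T (translate t f) x = potential w φ T f (x + t) := by
  simp only [potential, IsKernel.mollify_translate]

lemma intervalIntegrable_clm {X Y : Type*} [NormedAddCommGroup X] [NormedSpace ℝ X]
    [NormedAddCommGroup Y] [NormedSpace ℝ Y] (L : X →L[ℝ] Y) {g : ℝ → X} {a b : ℝ}
    (hg : IntervalIntegrable g volume a b) : IntervalIntegrable (fun s => L (g s)) volume a b :=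
  ⟨L.integrable_comp hg.1, L.integrable_comp hg.2⟩

lemma hasDerivAt_two_mul_sqrt {s : ℝ} (hs : 0 < s) : HasDerivAt (fun s => 2 * √s) (√s)⁻¹ s := by
  have := (Real.hasDerivAt_sqrt hs.ne').const_mul 2
  refine this.congr_deriv ?_
  have : √s ≠ 0 := (Real.sqrt_pos.2 hs).ne'
  field_simp

lemma intervalIntegrable_inv_sqrt {T : ℝ} (hT : 0 < T) :
    IntervalIntegrable (fun s => (√s)⁻¹) volume 0 T := by
  refine intervalIntegral.intervalIntegrable_deriv_of_nonneg (g := fun s => 2 * √s)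
    (by fun_prop) (fun s hs => ?_) (fun s _ => by positivity)
  rw [min_eq_left hT.le] at hs
  exact hasDerivAt_two_mul_sqrt hs.1

lemma integral_inv_sqrt {T : ℝ} (hT : 0 < T) : ∫ s in (0 : ℝ)..T, (√s)⁻¹ = 2 * √T := by
  rw [intervalIntegral.integral_eq_sub_of_hasDerivAt_of_le hT.le (f := fun s => 2 * √s)
    (by fun_prop) (fun s hs => hasDerivAt_two_mul_sqrt hs.1) (intervalIntegrable_inv_sqrt hT)]
  simp

/-- An integrable majorant of `min (s ^ (-1/2)) (d s ^ (-3/2))`. -/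
lemma integral_majorant {T b : ℝ} (hT : 0 < T) (hb : 0 < b) :
    IntervalIntegrable (fun s => b ^ 2 / (√s * (√s + b) ^ 2)) volume 0 T ∧
    ∫ s in (0 : ℝ)..T, b ^ 2 / (√s * (√s + b) ^ 2) ≤ 2 * b := by
  have hc : Continuous fun s => 2 * b * (√s / (√s + b)) := by
    refine continuous_const.mul (Real.continuous_sqrt.div (by fun_prop) fun s => ?_)
    have := Real.sqrt_nonneg s
    positivity
  have hd : ∀ s, 0 < s → HasDerivAt (fun s => 2 * b * (√s / (√s + b)))
      (b ^ 2 / (√s * (√s + b) ^ 2)) s := fun s hs => by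
    have h0 : 0 < √s := Real.sqrt_pos.2 hs
    have h1 := Real.hasDerivAt_sqrt hs.ne'
    have h2 := ((h1.div (h1.add_const b) (by positivity)).const_mul (2 * b))
    refine h2.congr_deriv ?_
    field_simp
    ring
  have hi : IntervalIntegrable (fun s => b ^ 2 / (√s * (√s + b) ^ 2)) volume 0 T := by
    refine intervalIntegral.intervalIntegrable_deriv_of_nonneg hc.continuousOn (fun s hs => ?_)
      (fun s _ => by positivity)
    rw [min_eq_left hT.le] at hs
    exact hd s hs.1
  refine ⟨hi, ?_⟩
  rw [intervalIntegral.integral_eq_sub_of_hasDerivAt_of_le hT.le hc.continuousOn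
    (fun s hs => hd s hs.1) hi]
  have h0 := Real.sqrt_nonneg T
  have : √T / (√T + b) ≤ 1 := by rw [div_le_one (by positivity)]; linarith
  simp only [Real.sqrt_zero, zero_div, mul_zero, sub_zero]
  nlinarith

variable {φ : E → V}

/-- The bound under which potentials converge. -/
def PotentialBound (w : ℝ → ℝ) (φ : E → V) (T C : ℝ) : Prop :=
  ∀ (f : Hol E ℝ) (x : E), ∀ s ∈ Ioc 0 T, ‖w s • mollify φ f s x‖ ≤ C * ‖f‖ * (√s)⁻¹

lemma IsKernel.aestronglyMeasurable_potential (h : IsKernel φ) {w : ℝ → ℝ} (hw : Measurable w)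
    (f : Hol E ℝ) (x : E) (μ : Measure ℝ) :
    AEStronglyMeasurable (fun s => w s • mollify φ f s x) μ := by
  refine hw.aestronglyMeasurable.smul (Continuous.aestronglyMeasurable ?_)
  exact (h.continuous_mollify f).comp (by fun_prop : Continuous fun s : ℝ => (s, x))

lemma PotentialBound.intervalIntegrable {w : ℝ → ℝ} {T C : ℝ} (hB : PotentialBound w φ T C)
    (h : IsKernel φ) (hw : Measurable w) (hT : 0 < T) (f : Hol E ℝ) (x : E) :
    IntervalIntegrable (fun s => w s • mollify φ f s x) volume 0 T := by
  refine ((intervalIntegrable_inv_sqrt hT).const_mul (C * ‖f‖)).mono_fun'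
    (h.aestronglyMeasurable_potential hw f x _) ?_
  rw [uIoc_of_le hT.le]
  exact (ae_restrict_iff' measurableSet_Ioc).2 (Eventually.of_forall (hB f x))

lemma PotentialBound.norm_le {w : ℝ → ℝ} {T C : ℝ} (hB : PotentialBound w φ T C)
    (hT : 0 < T) (f : Hol E ℝ) (x : E) :
    ‖potential w φ T f x‖ ≤ 2 * C * √T * ‖f‖ := by
  refine (intervalIntegral.norm_integral_le_of_norm_le hT.le (Eventually.of_forall (hB f x))
    ((intervalIntegrable_inv_sqrt hT).const_mul _)).trans_eq ?_
  rw [intervalIntegral.integral_const_mul, integral_inv_sqrt hT]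
  ring

lemma PotentialBound.exists_clm {w : ℝ → ℝ} {T C : ℝ} (hB : PotentialBound w φ T C)
    (h : IsKernel φ) (hw : Measurable w) (hT : 0 < T) (C' : ℝ)
    (hH : ∀ (f : Hol E ℝ) (x y : E), ‖∫ s in (0 : ℝ)..T, w s • (mollify φ f s x - mollify φ f s y)‖
      ≤ C' * ‖f‖ * √‖x - y‖) :
    ∃ A : Hol E ℝ →L[ℝ] Hol E V, ∀ f x, A f x = potential w φ T f x := by
  refine ⟨mkCLM (potential w φ T) (max (2 * C * √T) C') (fun u v x => ?_) (fun c u x => ?_)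
    (fun u x => ?_) (fun u x y => ?_), fun f x => mkCLM_apply ..⟩
  · simp only [potential, h.mollify_add, smul_add]
    exact intervalIntegral.integral_add (hB.intervalIntegrable h hw hT u x)
      (hB.intervalIntegrable h hw hT v x)
  · simp only [potential, IsKernel.mollify_smul]
    rw [← intervalIntegral.integral_smul]
    simp only [smul_comm c]
  · exact (hB.norm_le hT u x).trans (by gcongr; exact le_max_left _ _)
  · have := intervalIntegral.integral_sub (hB.intervalIntegrable h hw hT u x)
      (hB.intervalIntegrable h hw hT u y)
    simp only [potential]
    rw [← this]
    simp only [← smul_sub]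
    exact (hH u x y).trans (by gcongr; exact le_max_right _ _)

lemma PotentialBound.hasFDerivAt [CompleteSpace V] {w w' : ℝ → ℝ} {T C C' : ℝ}
    (hB : PotentialBound w φ T C)
    (hB' : PotentialBound w' (fderiv ℝ φ) T C')
    (h : IsKernel φ) (hw : Measurable w) (hw' : Measurable w') (hT : 0 < T)
    (hww : ∀ s, 0 < s → w s * s⁻¹ = w' s) (f : Hol E ℝ) (x : E) :
    HasFDerivAt (potential w φ T f) (potential w' (fderiv ℝ φ) T f x) x := by
  refine intervalIntegral.hasFDerivAt_integral_of_dominated_of_fderiv_le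
    (F := fun x s => w s • mollify φ f s x) (F' := fun x s => w' s • mollify (fderiv ℝ φ) f s x)
    (bound := fun s => C' * ‖f‖ * (√s)⁻¹) (s := univ) univ_mem
    (Eventually.of_forall fun y => h.aestronglyMeasurable_potential hw f y _)
    (hB.intervalIntegrable h hw hT f x) (h.fderiv.aestronglyMeasurable_potential hw' f x _)
    (Eventually.of_forall fun s hs y _ => ?_) ((intervalIntegrable_inv_sqrt hT).const_mul _)
    (Eventually.of_forall fun s hs y _ => ?_)
  · rw [uIoc_of_le hT.le] at hs
    exact hB' f y s hs
  · rw [uIoc_of_le hT.le] at hs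
    have := (h.hasFDerivAt_mollify_space f hs.1 y).const_smul (w s)
    rwa [smul_smul, hww s hs.1] at this

lemma IsKernel.potentialBound_of_le (h : IsKernel φ) {w : ℝ → ℝ} {T M : ℝ}
    (hM : ∀ s ∈ Ioc 0 T, |w s| ≤ M) : PotentialBound w φ T (M * IsKernel.mass φ * √T) := by
  intro f x s hs
  have h1 := h.norm_mollify_le f s x
  have h2 := hM s hs
  have h3 : 0 ≤ IsKernel.mass φ := IsKernel.mass_nonneg φ
  have h4 : 0 < √s := Real.sqrt_pos.2 hs.1
  have h5 : √s ≤ √T := Real.sqrt_le_sqrt hs.2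
  have hM0 : 0 ≤ M := (abs_nonneg _).trans h2
  rw [norm_smul, Real.norm_eq_abs, le_mul_inv_iff₀ h4]
  calc _ ≤ M * (IsKernel.mass φ * ‖f‖) * √T := by gcongr
    _ = _ := by ring

lemma IsKernel.holder_of_le (h : IsKernel φ) {w : ℝ → ℝ} {T M : ℝ} (hT : 0 < T)
    (hM : ∀ s ∈ Ioc 0 T, |w s| ≤ M) (f : Hol E ℝ) (x y : E) :
    ‖∫ s in (0 : ℝ)..T, w s • (mollify φ f s x - mollify φ f s y)‖
      ≤ (M * IsKernel.mass φ * T) * ‖f‖ * √‖x - y‖ := by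
  refine (intervalIntegral.norm_integral_le_of_norm_le_const
    (C := M * (IsKernel.mass φ * ‖f‖ * √‖x - y‖)) fun s hs => ?_).trans_eq ?_
  · rw [uIoc_of_le hT.le] at hs
    have h2 := hM s hs
    have hM0 : 0 ≤ M := (abs_nonneg _).trans h2
    rw [norm_smul, Real.norm_eq_abs]
    have := h.norm_mollify_sub_le f s x y
    gcongr
  · rw [sub_zero, abs_of_pos hT]
    ring

lemma IsKernel.potentialBound_inv [CompleteSpace V] (h : IsKernel φ) (h0 : ∫ z, φ z = 0) (T : ℝ) :
    PotentialBound (fun s => s⁻¹) φ T (IsKernel.mass φ) := by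
  intro f x s hs
  have h1 := h.norm_mollify_le_of_integral_eq_zero h0 f hs.1.le x
  have h4 : 0 < √s := Real.sqrt_pos.2 hs.1
  rw [norm_smul, norm_inv, Real.norm_of_nonneg hs.1.le, inv_mul_le_iff₀ hs.1]
  refine h1.trans_eq ?_
  have : s * (√s)⁻¹ = √s := by
    nth_rewrite 1 [← Real.mul_self_sqrt hs.1.le]
    field_simp
  rw [mul_left_comm, this]

lemma IsKernel.holder_inv [CompleteSpace V] (h : IsKernel φ) (h0 : ∫ z, φ z = 0) {T : ℝ}
    (hT : 0 < T) (f : Hol E ℝ) (x y : E) :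
    ‖∫ s in (0 : ℝ)..T, s⁻¹ • (mollify φ f s x - mollify φ f s y)‖
      ≤ (16 * (IsKernel.mass φ + IsKernel.mass (_root_.fderiv ℝ φ))) * ‖f‖ * √‖x - y‖ := by
  rcases eq_or_ne x y with rfl | hxy
  · simp
  set b := √‖x - y‖ with hb
  have hd : 0 < ‖x - y‖ := norm_pos_iff.2 (sub_ne_zero.2 hxy)
  have hb0 : 0 < b := Real.sqrt_pos.2 hd
  have hbb : ‖x - y‖ = b ^ 2 := (Real.sq_sqrt hd.le).symm
  set C := IsKernel.mass φ + IsKernel.mass (_root_.fderiv ℝ φ) with hC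
  have hm1 := IsKernel.mass_nonneg φ
  have hm2 := IsKernel.mass_nonneg (_root_.fderiv ℝ φ)
  have hC0 : 0 ≤ C := add_nonneg hm1 hm2
  obtain ⟨hi, hle⟩ := integral_majorant hT hb0
  refine (intervalIntegral.norm_integral_le_of_norm_le hT.le (g := fun s =>
    8 * C * ‖f‖ * (b ^ 2 / (√s * (√s + b) ^ 2))) (Eventually.of_forall fun s hs => ?_)
    (hi.const_mul _)).trans ?_
  · have ha0 : 0 < √s := Real.sqrt_pos.2 hs.1
    have hsa : s = √s ^ 2 := (Real.sq_sqrt hs.1.le).symm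
    have h1 : ‖mollify φ f s x - mollify φ f s y‖ ≤ 2 * (C * ‖f‖ * √s) := by
      have e1 := h.norm_mollify_le_of_integral_eq_zero h0 f hs.1.le x
      have e2 := h.norm_mollify_le_of_integral_eq_zero h0 f hs.1.le y
      have e3 : IsKernel.mass φ * ‖f‖ * √s ≤ C * ‖f‖ * √s := by gcongr; linarith
      exact (_root_.norm_sub_le _ _).trans (by linarith)
    have h2 : ‖mollify φ f s x - mollify φ f s y‖ ≤ C * ‖f‖ * (√s)⁻¹ * b ^ 2 := by
      rw [← hbb]
      refine convex_univ.norm_image_sub_le_of_norm_hasFDerivWithin_le (𝕜 := ℝ)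
        (fun z _ => (h.hasFDerivAt_mollify_space f hs.1 z).hasFDerivWithinAt) (fun z _ => ?_)
        (mem_univ y) (mem_univ x)
      refine (h.fderiv.potentialBound_inv h.integral_fderiv T f z s hs).trans ?_
      gcongr
      linarith
    rw [norm_smul, norm_inv, Real.norm_of_nonneg hs.1.le, inv_mul_le_iff₀ hs.1]
    nth_rewrite 3 [hsa]
    generalize √s = a at *
    have hCf : 0 ≤ C * ‖f‖ := by positivity
    have key : a ^ 2 * (8 * C * ‖f‖ * (b ^ 2 / (a * (a + b) ^ 2))) =
      C * ‖f‖ * (8 * a * b ^ 2 / (a + b) ^ 2) := by field_simp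
    rw [key]
    rcases le_total a b with hab | hab
    · refine h1.trans ?_
      have : 2 * a ≤ 8 * a * b ^ 2 / (a + b) ^ 2 := by
        rw [le_div_iff₀ (by positivity)]
        have : (a + b) ^ 2 ≤ (2 * b) ^ 2 := by gcongr; linarith
        nlinarith
      calc _ = C * ‖f‖ * (2 * a) := by ring
        _ ≤ _ := mul_le_mul_of_nonneg_left this hCf
    · refine h2.trans ?_
      rw [mul_assoc]
      refine mul_le_mul_of_nonneg_left ?_ hCf
      rw [le_div_iff₀ (by positivity), inv_mul_eq_div, div_mul_eq_mul_div, div_le_iff₀ ha0]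
      nlinarith [mul_nonneg (sq_nonneg b) (mul_nonneg (sub_nonneg.2 hab) (add_pos ha0 hb0).le), mul_pos ha0 ha0, mul_nonneg (sq_nonneg b) (sq_nonneg (a)), mul_nonneg (sq_nonneg b) (mul_nonneg (sub_nonneg.2 hab) ha0.le)]
  · rw [intervalIntegral.integral_const_mul]
    calc _ ≤ 8 * C * ‖f‖ * (2 * b) := by gcongr
      _ = _ := by ring

/-- The potentials of a kernel `ψ` and its derivatives: `A₁` and `A₂` give the first and second
derivatives of `A₀ f`, and a second order operator `L` with `L ψ` the derivative in the scale of a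
mollifying kernel `ρ` inverts `A₀` up to a smoothing error. -/
theorem exists_potentials {ψ : E → ℝ} (h : IsKernel ψ) {T : ℝ} (hT : 0 < T) :
    ∃ (A₀ : Hol E ℝ →L[ℝ] Hol E ℝ) (A₁ : Hol E ℝ →L[ℝ] Hol E (E →L[ℝ] ℝ))
      (A₂ : Hol E ℝ →L[ℝ] Hol E (E →L[ℝ] E →L[ℝ] ℝ)),
      (∀ f x, HasFDerivAt (A₀ f) (A₁ f x) x) ∧ (∀ f x, HasFDerivAt (A₁ f) (A₂ f x) x) ∧
      (∀ t f x, A₀ (translate t f) x = A₀ f (x + t)) ∧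
      (∀ t f x, A₁ (translate t f) x = A₁ f (x + t)) ∧
      (∀ t f x, A₂ (translate t f) x = A₂ f (x + t)) ∧
      ∀ (L : (E →L[ℝ] E →L[ℝ] ℝ) →L[ℝ] ℝ) (ρ : E → ℝ), IsKernel ρ → ∫ z, ρ z = 1 →
        (∀ z, L (fderiv ℝ (fderiv ℝ ψ) z) = scaleDeriv ρ z) →
        ∀ f x, L (A₂ f x) = mollify ρ f T x - f x := by
  have b0 : ∀ s ∈ Ioc 0 T, |id s| ≤ T := fun s hs => by simpa [abs_of_pos hs.1] using hs.2
  have b1 : ∀ s ∈ Ioc 0 T, |(fun _ : ℝ => (1 : ℝ)) s| ≤ 1 := fun s _ => by simp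
  have B0 := h.potentialBound_of_le b0
  have B1 := h.fderiv.potentialBound_of_le b1
  have B2 := h.fderiv.fderiv.potentialBound_inv h.fderiv.integral_fderiv T
  obtain ⟨A₀, hA₀⟩ := B0.exists_clm h measurable_id hT _ (h.holder_of_le hT b0)
  obtain ⟨A₁, hA₁⟩ := B1.exists_clm h.fderiv measurable_const hT _ (h.fderiv.holder_of_le hT b1)
  obtain ⟨A₂, hA₂⟩ := B2.exists_clm h.fderiv.fderiv measurable_inv hT _
    (h.fderiv.fderiv.holder_inv h.fderiv.integral_fderiv hT)
  refine ⟨A₀, A₁, A₂, fun f x => ?_, fun f x => ?_, fun t f x => ?_, fun t f x => ?_,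
    fun t f x => ?_, fun L ρ hρ hρ1 hL f x => ?_⟩
  · rw [hA₁, funext (hA₀ f)]
    exact B0.hasFDerivAt B1 h measurable_id measurable_const hT
      (fun s hs => mul_inv_cancel₀ hs.ne') f x
  · rw [hA₂, funext (hA₁ f)]
    exact B1.hasFDerivAt B2 h.fderiv measurable_const measurable_inv hT (fun s _ => one_mul _) f x
  · rw [hA₀, hA₀, potential_translate]
  · rw [hA₁, hA₁, potential_translate]
  · rw [hA₂, hA₂, potential_translate]
  · have hi := B2.intervalIntegrable h.fderiv.fderiv measurable_inv hT f x
    have e : ∀ s, L (s⁻¹ • mollify (fderiv ℝ (fderiv ℝ ψ)) f s x) =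
        s⁻¹ • mollify (scaleDeriv ρ) f s x := fun s => by
      rw [map_smul, ← h.fderiv.fderiv.mollify_comp_clm, funext hL]
    rw [hA₂, potential, ← L.intervalIntegral_comp_comm hi]
    have hi' : IntervalIntegrable (fun s => s⁻¹ • mollify (scaleDeriv ρ) f s x) volume 0 T := by
      simp only [← e]
      exact intervalIntegrable_clm L hi
    simp only [e]
    rw [intervalIntegral.integral_eq_sub_of_hasDerivAt_of_le hT.le
      (f := fun s => mollify ρ f s x)
      ((hρ.continuous_mollify f).comp (by fun_prop : Continuous fun s : ℝ => (s, x))).continuousOn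
      (fun s hs => hρ.hasDerivAt_mollify_scale f hs.1 x) hi', IsKernel.mollify_zero, hρ1]
    simp

end potential

section kernel

set_option linter.unusedSectionVars false

variable {E : Type} [NormedAddCommGroup E] [InnerProductSpace ℝ E] [FiniteDimensional ℝ E]

/-- The rank one bilinear form `p ⊗ q`. -/
def tens (p q : E →L[ℝ] ℝ) : E →L[ℝ] E →L[ℝ] ℝ := p.smulRight q

omit [FiniteDimensional ℝ E] in
@[simp] lemma tens_apply (p q : E →L[ℝ] ℝ) (x y : E) : tens p q x y = p x * q y := by
  simp [tens]

/-- A form `L` positive on the squares of covectors is diagonal in some basis of covectors. -/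
lemma exists_diagonalizing (L : (E →L[ℝ] E →L[ℝ] ℝ) →L[ℝ] ℝ)
    (hL : ∀ p : E →L[ℝ] ℝ, p ≠ 0 → 0 < L (tens p p)) :
    ∃ p : Fin (Module.finrank ℝ E) → (E →L[ℝ] ℝ), (∀ z, (∀ i, p i z = 0) → z = 0) ∧
      ∀ i j, L (tens (p i) (p j)) + L (tens (p j) (p i)) = if i = j then 2 else 0 := by
  have a1 : ∀ p p' q : E →L[ℝ] ℝ, L (tens (p + p') q) = L (tens p q) + L (tens p' q) :=
    fun p p' q => by rw [← map_add]; congr 1; ext; simp [add_mul]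
  have a2 : ∀ p q q' : E →L[ℝ] ℝ, L (tens p (q + q')) = L (tens p q) + L (tens p q') :=
    fun p p' q => by rw [← map_add]; congr 1; ext; simp [mul_add]
  have a3 : ∀ (c : ℝ) (p q : E →L[ℝ] ℝ), L (tens (c • p) q) = c * L (tens p q) :=
    fun c p q => by rw [← smul_eq_mul, ← map_smul]; congr 1; ext; simp [mul_assoc]
  have a4 : ∀ (c : ℝ) (p q : E →L[ℝ] ℝ), L (tens p (c • q)) = c * L (tens p q) :=
    fun c p q => by rw [← smul_eq_mul, ← map_smul]; congr 1; ext; simp; ring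
  let B : LinearMap.BilinForm ℝ (E →L[ℝ] ℝ) := LinearMap.mk₂ ℝ
    (fun p q => L (tens p q) + L (tens q p)) (by intros; rw [a1, a2]; ring)
    (by intros; rw [a3, a4]; simp; ring)
    (by intros; rw [a1, a2]; ring) (by intros; rw [a3, a4]; simp; ring)
  have hB : ∀ p q, B p q = L (tens p q) + L (tens q p) := fun _ _ => rfl
  have hs : LinearMap.IsSymm B := ⟨fun p q => by simp [hB, add_comm]⟩
  have hd : Module.finrank ℝ (E →L[ℝ] ℝ) = Module.finrank ℝ E :=
    ((InnerProductSpace.toDual ℝ E).toLinearEquiv.finrank_eq).symm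
  obtain ⟨v, hv⟩ : ∃ v : Module.Basis (Fin (Module.finrank ℝ E)) ℝ (E →L[ℝ] ℝ),
      B.IsOrthoᵢ v := hd ▸ LinearMap.BilinForm.exists_orthogonal_basis hs
  have hpos : ∀ i, 0 < L (tens (v i) (v i)) := fun i => hL _ (v.ne_zero i)
  refine ⟨fun i => (√(L (tens (v i) (v i))))⁻¹ • v i, fun z hz => ?_, fun i j => ?_⟩
  · have h0 : ∀ q : E →L[ℝ] ℝ, q z = 0 := fun q => by
      have : (v.constr ℝ fun i => v i z) = (ContinuousLinearMap.apply ℝ ℝ z).toLinearMap :=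
        v.ext fun i => by simp
      have e := congrArg (fun T => T q) this
      simp only [Module.Basis.constr_apply_fintype] at e
      rw [show q z = (ContinuousLinearMap.apply ℝ ℝ z).toLinearMap q from rfl, ← e]
      refine Finset.sum_eq_zero fun i _ => ?_
      have := hz i
      simp only [_root_.smul_apply, smul_eq_mul, mul_eq_zero, inv_eq_zero] at this
      rcases this with h | h
      · exact absurd h (Real.sqrt_pos.2 (hpos i)).ne'
      · simp [h]
    have := h0 (InnerProductSpace.toDual ℝ E z)
    simpa using this
  · simp only [a3, a4]
    split_ifs with h
    · subst h
      have := Real.sq_sqrt (hpos i).le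
      have := (Real.sqrt_pos.2 (hpos i)).ne'
      set s := √(L (tens (v i) (v i)))
      rw [← Real.sq_sqrt (hpos i).le]
      change s⁻¹ * (s⁻¹ * s ^2) + s⁻¹ * (s⁻¹ * s ^2) = 2
      field_simp; norm_num
    · have : B (v i) (v j) = 0 := hv h
      rw [hB] at this
      linear_combination (√(L (tens (v i) (v i))))⁻¹ * (√(L (tens (v j) (v j))))⁻¹ * this

/-- The sum of the squares of the covectors `p i`. -/
def sqForm {m : ℕ} (p : Fin m → (E →L[ℝ] ℝ)) : E →L[ℝ] E →L[ℝ] ℝ := ∑ i, tens (p i) (p i)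

omit [FiniteDimensional ℝ E] in
lemma sqForm_apply {m : ℕ} (p : Fin m → (E →L[ℝ] ℝ)) (x y : E) :
    sqForm p x y = ∑ i, p i x * p i y := by simp [sqForm]

variable [MeasurableSpace E] [BorelSpace E]

lemma isKernel_sqForm {m : ℕ} {p : Fin m → (E →L[ℝ] ℝ)} (hp : ∀ z, (∀ i, p i z = 0) → z = 0)
    {h : ℝ → ℝ} (hh : ContDiff ℝ ∞ h) (h1 : ∀ r, 1 ≤ r → h r = 0) :
    IsKernel fun z => h (sqForm p z z / 2) := by
  refine ⟨by fun_prop, ?_⟩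
  let P : E →L[ℝ] EuclideanSpace ℝ (Fin m) :=
    (EuclideanSpace.equiv (Fin m) ℝ).symm.toContinuousLinearMap.comp (ContinuousLinearMap.pi p)
  have hP : ∀ z i, P z i = p i z := fun z i => rfl
  have hi : P.toLinearMap.ker = ⊥ := by
    refine LinearMap.ker_eq_bot'.2 fun z hz => hp z fun i => ?_
    rw [← hP, show P z = 0 from hz]; rfl
  have hc : HasCompactSupport fun y : EuclideanSpace ℝ (Fin m) => h (‖y‖ ^ 2 / 2) := by
    refine HasCompactSupport.of_support_subset_isCompact (isCompact_closedBall 0 2) fun y hy => ?_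
    by_contra hn
    rw [mem_closedBall_zero_iff, not_le] at hn
    exact hy (h1 _ (by nlinarith))
  have := hc.comp_isClosedEmbedding (LinearMap.isClosedEmbedding_of_injective hi)
  suffices e : (fun z => h (sqForm p z z / 2)) = (fun y => h (‖y‖ ^ 2 / 2)) ∘ P by rw [e]; exact this
  funext z
  simp only [Function.comp, sqForm_apply, EuclideanSpace.norm_sq_eq]
  congr 2
  refine Finset.sum_congr rfl fun i _ => ?_
  change _ = ‖P z i‖ ^ 2
  rw [hP, Real.norm_eq_abs, sq_abs, sq]

lemma hasFDerivAt_comp_sqForm {m : ℕ} (p : Fin m → (E →L[ℝ] ℝ)) {h : ℝ → ℝ} {h' : ℝ} (z : E)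
    (hh : HasDerivAt h h' (sqForm p z z / 2)) :
    HasFDerivAt (fun z => h (sqForm p z z / 2)) (h' • sqForm p z) z := by
  have : HasFDerivAt (fun z => sqForm p z z / 2) (sqForm p z) z := by
    have := ((sqForm p).hasFDerivAt.clm_apply (hasFDerivAt_id z)).mul_const (2 : ℝ)⁻¹
    simp only [div_eq_mul_inv]
    refine this.congr_fderiv ?_
    ext y
    simp only [_root_.smul_apply, _root_.add_apply,
      ContinuousLinearMap.comp_apply, ContinuousLinearMap.flip_apply, sqForm_apply, smul_eq_mul, ContinuousLinearMap.id_apply, id]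
    simp only [mul_comm (p _ y)]
    ring
  exact hh.comp_hasFDerivAt z this

lemma sqForm_identity {p : Fin (Module.finrank ℝ E) → (E →L[ℝ] ℝ)}
    {L : (E →L[ℝ] E →L[ℝ] ℝ) →L[ℝ] ℝ}
    (hL : ∀ i j, L (tens (p i) (p j)) + L (tens (p j) (p i)) = if i = j then 2 else 0)
    {h : ℝ → ℝ} (hh : ContDiff ℝ ∞ h) (z : E) :
    L (fderiv ℝ (fderiv ℝ fun z => h (sqForm p z z / 2)) z) =
      scaleDeriv (fun z => -deriv h (sqForm p z z / 2)) z := by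
  have d1 : ∀ r, HasDerivAt h (deriv h r) r := fun r => (hh.differentiable (by simp) r).hasDerivAt
  have hh' : ContDiff ℝ ∞ (deriv h) := contDiff_infty_iff_deriv.1 hh |>.2
  have d2 : ∀ r, HasDerivAt (deriv h) (deriv (deriv h) r) r :=
    fun r => (hh'.differentiable (by simp) r).hasDerivAt
  have f1 : fderiv ℝ (fun z => h (sqForm p z z / 2)) =
      fun z => deriv h (sqForm p z z / 2) • sqForm p z :=
    funext fun z => (hasFDerivAt_comp_sqForm p z (d1 _)).fderiv
  have f2 := (hasFDerivAt_comp_sqForm p z (d2 _))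
  have f3 := f2.smul (sqForm p).hasFDerivAt
  have s1 : L (sqForm p) = Module.finrank ℝ E := by
    have : ∀ i, L (tens (p i) (p i)) = 1 := fun i => by have := hL i i; simp at this; linarith
    simp [sqForm, this]
  have s2 : L (tens (sqForm p z) (sqForm p z)) = sqForm p z z := by
    have e : tens (sqForm p z) (sqForm p z) =
        ∑ i, ∑ j, (p i z * p j z / 2) • (tens (p i) (p j) + tens (p j) (p i)) := by
      ext x y
      simp only [tens_apply, sqForm_apply, _root_.sum_apply,
        _root_.smul_apply, _root_.add_apply, smul_eq_mul,
        Finset.sum_mul_sum]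
      have : ∀ a b : Fin (Module.finrank ℝ E) → ℝ, ∑ i, ∑ j, a i * b j = ∑ i, ∑ j, b i * a j :=
        fun a b => by rw [Finset.sum_comm]; simp [mul_comm]
      have h2 := this (fun i => p i z * p i x) (fun i => p i z * p i y)
      have h3 : ∑ i, ∑ j, p i z * p j z / 2 * (p i x * p j y + p j x * p i y) =
        (∑ i, ∑ j, p i z * p i x * (p j z * p j y)) / 2 +
          (∑ i, ∑ j, p i z * p i y * (p j z * p j x)) / 2 := by
        simp only [Finset.sum_div, ← Finset.sum_add_distrib]
        refine Finset.sum_congr rfl fun i _ => Finset.sum_congr rfl fun j _ => by ring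
      rw [h3, ← h2]; ring
    rw [e]
    simp only [map_sum, map_smul, map_add, hL, smul_eq_mul, sqForm_apply]
    refine Finset.sum_congr rfl fun i _ => ?_
    simp
  have f4 : HasFDerivAt (fun z => -deriv h (sqForm p z z / 2))
      (-(deriv (deriv h) (sqForm p z z / 2) • sqForm p z)) z := f2.neg
  have f5 : fderiv ℝ (fun z => deriv h (sqForm p z z / 2) • sqForm p z) z = _ := f3.fderiv
  rw [f1, f5, scaleDeriv, f4.fderiv]
  simp only [map_add, map_smul, s1]
  rw [show ContinuousLinearMap.smulRight (deriv (deriv h) (sqForm p z z / 2) • sqForm p z)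
    (sqForm p z) = deriv (deriv h) (sqForm p z z / 2) • tens (sqForm p z) (sqForm p z) by
      ext; simp [mul_assoc], map_smul, s2]
  simp
  ring

/-- A second order operator with positive definite symbol has a kernel whose image is the scale
derivative of a mollifying kernel. -/
theorem exists_kernel [Nontrivial E] (L : (E →L[ℝ] E →L[ℝ] ℝ) →L[ℝ] ℝ)
    (hL : ∀ p : E →L[ℝ] ℝ, p ≠ 0 → 0 < L (tens p p)) :
    ∃ ψ ρ : E → ℝ, IsKernel ψ ∧ IsKernel ρ ∧ ∫ z, ρ z = 1 ∧
      ∀ z, L (fderiv ℝ (fderiv ℝ ψ) z) = scaleDeriv ρ z := by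
  obtain ⟨p, hp, hpL⟩ := exists_diagonalizing L hL
  let k : ℝ → ℝ := fun r => Real.smoothTransition (1 - r)
  have hk : ContDiff ℝ ∞ k := by
    have : ContDiff ℝ ∞ Real.smoothTransition := Real.smoothTransition.contDiff
    fun_prop
  have hanti : Antitone k := fun a b hab => Real.smoothTransition.monotone (by linarith)
  have hk1 : ∀ r, 1 ≤ r → k r = 0 := fun r hr =>
    Real.smoothTransition.zero_of_nonpos (by linarith)
  have hd : ContDiff ℝ ∞ (deriv k) := contDiff_infty_iff_deriv.1 hk |>.2
  have hd0 : ∀ r, deriv k r ≤ 0 := fun r => hanti.deriv_nonpos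
  have hd1 : ∀ r, 1 ≤ r → deriv k r = 0 := by
    have ho : ∀ r, 1 < r → deriv k r = 0 := fun r hr => by
      have : k =ᶠ[𝓝 r] fun _ => 0 := by
        filter_upwards [Ioi_mem_nhds hr] with s hs using hk1 s (le_of_lt hs)
      rw [this.deriv_eq]; simp
    intro r hr
    rcases hr.eq_or_lt with rfl | h
    · have c1 : Tendsto (deriv k) (𝓝[>] 1) (𝓝 (deriv k 1)) :=
        (hd.continuous.tendsto 1).mono_left nhdsWithin_le_nhds
      have c2 : Tendsto (deriv k) (𝓝[>] 1) (𝓝 0) :=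
        tendsto_const_nhds.congr' (by
          filter_upwards [self_mem_nhdsWithin] with s hs using (ho s hs).symm)
      exact tendsto_nhds_unique c1 c2
    · exact ho r h
  have K := isKernel_sqForm hp (h := fun r => -deriv k r) hd.neg (fun r hr => by simp [hd1 r hr])
  obtain ⟨r₀, hr₀, hr₁⟩ := exists_deriv_eq_slope k one_pos hk.continuous.continuousOn
    (hk.differentiable (by simp)).differentiableOn
  have hr₂ : deriv k r₀ = -1 := by rw [hr₁]; simp [k]
  obtain ⟨z₁, hz₁⟩ := exists_ne (0 : E)
  have hq : 0 < sqForm p z₁ z₁ := by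
    have h0 : 0 ≤ sqForm p z₁ z₁ := by
      rw [sqForm_apply]; exact Finset.sum_nonneg fun i _ => mul_self_nonneg _
    refine h0.lt_of_ne fun h => hz₁ (hp z₁ fun i => ?_)
    rw [sqForm_apply, eq_comm, Finset.sum_eq_zero_iff_of_nonneg fun i _ => mul_self_nonneg _] at h
    exact mul_self_eq_zero.1 (h i (Finset.mem_univ _))
  have hpos : 0 < ∫ z, -deriv k (sqForm p z z / 2) := by
    refine K.smooth.continuous.integral_pos_of_hasCompactSupport_nonneg_nonzero K.supp
      (fun z => by simpa using hd0 _) (x := √(2 * r₀ / sqForm p z₁ z₁) • z₁) ?_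
    have : sqForm p (√(2 * r₀ / sqForm p z₁ z₁) • z₁) (√(2 * r₀ / sqForm p z₁ z₁) • z₁) / 2 = r₀ := by
      simp only [map_smul, _root_.smul_apply, smul_eq_mul]
      rw [← mul_assoc, Real.mul_self_sqrt (div_nonneg (by linarith [hr₀.1]) hq.le)]
      field_simp
    rw [this, hr₂]; norm_num
  set c := ∫ z, -deriv k (sqForm p z z / 2) with hc
  let h : ℝ → ℝ := fun r => c⁻¹ * k r
  have hh : ContDiff ℝ ∞ h := contDiff_const.mul hk
  have hhd : ∀ r, deriv h r = c⁻¹ * deriv k r := fun r => by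
    simp only [h]; rw [deriv_const_mul _ (hk.differentiable (by simp) r)]
  refine ⟨_, _, isKernel_sqForm hp hh fun r hr => by simp [h, hk1 r hr],
    isKernel_sqForm hp (h := fun r => -deriv h r) (contDiff_infty_iff_deriv.1 hh).2.neg
      (fun r hr => by simp [hhd, hd1 r hr]), ?_, fun z => sqForm_identity hpL hh z⟩
  have : ∀ z : E, -deriv h (sqForm p z z / 2) = c⁻¹ * -deriv k (sqForm p z z / 2) := fun z => by
    rw [hhd]; ring
  simp only [this]
  rw [integral_const_mul, ← hc, inv_mul_cancel₀ hpos.ne']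

end kernel

section cutoff

set_option linter.unusedSectionVars false

variable {E V W : Type} [NormedAddCommGroup E] [InnerProductSpace ℝ E] [FiniteDimensional ℝ E]
  [MeasurableSpace E] [BorelSpace E] [NormedAddCommGroup V] [NormedSpace ℝ V]
  [NormedAddCommGroup W] [NormedSpace ℝ W]

/-- Smooth compactly supported functions are bounded and Hölder. -/
lemma IsKernel.exists_hol {φ : E → V} (h : IsKernel φ) : ∃ f : Hol E V, ∀ x, f x = φ x := by
  obtain ⟨C, hC⟩ := h.supp.exists_bound_of_continuous h.smooth.continuous
  obtain ⟨K, hK⟩ := h.smooth.lipschitzWith_of_hasCompactSupport h.supp (by simp)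
  have hC0 : 0 ≤ C := (norm_nonneg _).trans (hC 0)
  have h2 : ∀ x y, ‖φ x - φ y‖ ≤ (2 * C + K) * √‖x - y‖ := fun x y => by
    have hb : ‖φ x - φ y‖ ≤ 2 * C := (_root_.norm_sub_le _ _).trans (by linarith [hC x, hC y])
    have hl : ‖φ x - φ y‖ ≤ K * ‖x - y‖ := hK.norm_sub_le x y
    have hs := Real.sq_sqrt (norm_nonneg (x - y))
    have hs0 := Real.sqrt_nonneg ‖x - y‖
    have hK0 : (0 : ℝ) ≤ K := K.2
    set s := √‖x - y‖
    rcases le_total s 1 with h1 | h1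
    · rw [← hs] at hl
      nlinarith [mul_nonneg hK0 (mul_nonneg hs0 (sub_nonneg.2 h1)), mul_nonneg hC0 hs0]
    · nlinarith [mul_nonneg hC0 (sub_nonneg.2 h1), mul_nonneg hK0 hs0]
  exact ⟨Hol.mk φ (2 * C + K) (fun x => (hC x).trans (by linarith [hC0, K.coe_nonneg])) h2,
    fun x => mk_apply ..⟩

/-- The pointwise product. -/
def mul : Hol E ℝ →L[ℝ] Hol E ℝ →L[ℝ] Hol E ℝ := bilin (ContinuousLinearMap.mul ℝ ℝ)

@[simp] lemma mul_apply (f g : Hol E ℝ) (x : E) : mul f g x = f x * g x := by simp [mul]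

lemma exists_bump (R : ℝ) : ∃ η : E → ℝ, IsKernel η ∧ ∀ x, ‖x‖ ≤ R → η x = 1 := by
  let η : ContDiffBump (0 : E) := ⟨|R| + 1, |R| + 2, by positivity, by linarith⟩
  refine ⟨η, ⟨η.contDiff, η.hasCompactSupport⟩, fun x hx => η.one_of_mem_closedBall ?_⟩
  rw [mem_closedBall_zero_iff]
  exact hx.trans ((le_abs_self R).trans (by simp [η]))

/-- The translates of a kernel depend smoothly on the translation. -/
lemma IsKernel.exists_smooth_translate [FiniteDimensional ℝ V] {φ : E → V} (h : IsKernel φ) :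
    ∃ Θ : E → Hol E V, ContDiff ℝ ∞ Θ ∧ ∀ t, ‖t‖ < 1 → ∀ x, Θ t x = φ (x + t) := by
  obtain ⟨R, hR⟩ := h.supp.isCompact.isBounded.exists_norm_le
  have hφ : ∀ x, φ x ≠ 0 → ‖x‖ ≤ R := fun x hx => hR x (subset_tsupport _ hx)
  obtain ⟨η₁, k₁, h₁⟩ := exists_bump (E := E) (R + 1)
  obtain ⟨S, hS⟩ := k₁.supp.isCompact.isBounded.exists_norm_le
  obtain ⟨η₂, k₂, h₂⟩ := exists_bump (E := E) S
  have k₃ : IsKernel fun x : E => η₂ x • x := ⟨k₂.smooth.smul contDiff_id, k₂.supp.smul_right⟩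
  obtain ⟨f₁, hf₁⟩ := k₁.exists_hol
  obtain ⟨β, hβ⟩ := k₃.exists_hol
  refine ⟨fun t => bilin (ContinuousLinearMap.lsmul ℝ ℝ) f₁ (comp φ (β + const t)),
    (ContinuousLinearMap.contDiff _).comp
      ((contDiff_comp h.smooth).comp (contDiff_const.add (ContinuousLinearMap.contDiff _))),
    fun t ht x => ?_⟩
  have h1 : ContDiff ℝ 1 φ := h.smooth.of_le (by exact_mod_cast le_top)
  simp only [bilin_apply, comp_apply h1, hf₁, add_apply, hβ, const_apply,
    ContinuousLinearMap.lsmul_apply]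
  by_cases hx : η₁ x = 0
  · rw [hx, zero_smul]
    by_contra hn
    have := hφ _ (Ne.symm hn)
    have h3 : ‖x‖ ≤ ‖x + t‖ + ‖t‖ := by simpa using _root_.norm_sub_le (x + t) t
    rw [h₁ x (by linarith)] at hx
    exact one_ne_zero hx
  · rw [h₂ x (hS x (subset_tsupport _ hx)), one_smul]
    by_cases h0 : φ (x + t) = 0
    · simp [h0]
    · have := hφ _ h0
      have h3 : ‖x‖ ≤ ‖x + t‖ + ‖t‖ := by simpa using _root_.norm_sub_le (x + t) t
      rw [h₁ x (by linarith), one_smul]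

/-- Localized mollifications at a large scale are small. -/
lemma exists_norm_mollify_mul_le [Nontrivial E] {ρ χ : E → ℝ} (hρ : IsKernel ρ) (hχ : IsKernel χ)
    {c : Hol E ℝ} (hc : ∀ x, c x = χ x) :
    ∃ C, 0 ≤ C ∧ ∀ T, 1 ≤ T → ∀ f g : Hol E ℝ, (∀ x, g x = mollify ρ (mul c f) T x) →
      ‖g‖ ≤ C * T⁻¹ * ‖f‖ := by
  obtain ⟨r, hr⟩ := hρ.exists_hol
  have hi : Integrable χ := hχ.integrable
  have hN : 0 ≤ ∫ t, ‖χ t‖ := integral_nonneg fun _ => norm_nonneg _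
  refine ⟨‖r‖ * ∫ t, ‖χ t‖, by positivity, fun T hT f g hg => ?_⟩
  have hT0 : 0 < T := by linarith
  have hTn : (T ^ Module.finrank ℝ E)⁻¹ ≤ T⁻¹ := by
    apply inv_anti₀ hT0
    exact le_self_pow₀ hT (Module.finrank_pos (R := ℝ) (M := E)).ne'
  have hTn0 : 0 ≤ (T ^ Module.finrank ℝ E)⁻¹ := by positivity
  have key : ∀ (k : E → ℝ) (D : ℝ), 0 ≤ D → (∀ t, ‖k t‖ ≤ T⁻¹ * (‖r‖ * D)) →
      ‖∫ t, (c t * f t) * k t‖ ≤ (‖r‖ * ∫ t, ‖χ t‖) * T⁻¹ * ‖f‖ * D := fun k D hD hk => by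
    calc _ ≤ ∫ t, ‖χ t‖ * (‖f‖ * (T⁻¹ * (‖r‖ * D))) := by
          refine norm_integral_le_of_norm_le (hi.norm.mul_const _) (Eventually.of_forall fun t => ?_)
          rw [norm_mul, norm_mul, hc, mul_assoc]
          gcongr
          · exact norm_apply_le f t
          · exact hk t
      _ = _ := by rw [integral_mul_const]; ring
  have e : ∀ x, g x = ∫ t, (c t * f t) * rescale ρ T (x - t) := fun x => by
    rw [hg, mollify_eq_convolution _ _ hT0]; simp
  have h_int : ∀ x, Integrable fun t => (c t * f t) * rescale ρ T (x - t) := fun x => by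
    have hcont : Continuous fun t => f t * rescale ρ T (x - t) := by
      have := f.continuous
      have := (hρ.rescale hT0).smooth.continuous
      fun_prop
    have := hχ.integrable_smul hcont
    refine this.congr (Eventually.of_forall fun t => ?_)
    simp only [hc, smul_eq_mul]; ring
  refine norm_le (fun x => ?_) (fun x y => ?_)
  · rw [e]
    have := key (fun t => rescale ρ T (x - t)) 1 zero_le_one fun t => by
      rw [rescale, norm_smul, ← hr, mul_one, Real.norm_of_nonneg hTn0]
      gcongr
      exact norm_apply_le r _
    simpa using this
  · rw [e, e, ← integral_sub (h_int x) (h_int y)]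
    simp only [← mul_sub]
    refine key _ _ (Real.sqrt_nonneg _) fun t => ?_
    rw [rescale, rescale, ← smul_sub, norm_smul, ← hr, ← hr, Real.norm_of_nonneg hTn0]
    gcongr
    refine (norm_sub_le r _ _).trans ?_
    rw [← smul_sub, norm_smul, sub_sub_sub_cancel_right]
    gcongr
    rw [Real.norm_of_nonneg (by positivity)]
    exact mul_le_of_le_one_left (norm_nonneg _) (inv_le_one_of_one_le₀ hT)

end cutoff

section implicit

/-- The smooth implicit function theorem, with smoothness in a neighbourhood. -/
theorem exists_implicit {X Y : Type} [NormedAddCommGroup X] [NormedSpace ℝ X] [CompleteSpace X]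
    [NormedAddCommGroup Y] [NormedSpace ℝ Y] [CompleteSpace Y] {Φ : X × Y → Y}
    (hΦ : ContDiff ℝ ∞ Φ) (h0 : Φ 0 = 0) (e : Y ≃L[ℝ] Y) (he : ∀ y, fderiv ℝ Φ 0 (0, y) = e y) :
    ∃ g : X → Y, g 0 = 0 ∧ (∀ᶠ x in 𝓝 0, ContDiffAt ℝ ∞ g x) ∧ (∀ᶠ x in 𝓝 0, Φ (x, g x) = 0) ∧
      (∀ᶠ p : X × Y in 𝓝 0, Φ p = 0 → p.2 = g p.1) ∧
      ∀ x, fderiv ℝ Φ 0 (x, 0) = 0 → fderiv ℝ g 0 x = 0 := by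
  let Ψ : X × Y → X × Y := fun p => (p.1, Φ p)
  have hΨ : ContDiff ℝ ∞ Ψ := contDiff_fst.prodMk hΦ
  let D : X × Y → (X × Y →L[ℝ] X × Y) := fun p =>
    (ContinuousLinearMap.fst ℝ X Y).prod (fderiv ℝ Φ p)
  have hD : ∀ p, HasFDerivAt Ψ (D p) p := fun p =>
    hasFDerivAt_fst.prodMk (hΦ.differentiable (by simp) p).hasFDerivAt
  have hdec : ∀ x y, fderiv ℝ Φ 0 (x, y) = fderiv ℝ Φ 0 (x, 0) + e y := fun x y => by
    rw [← he, ← map_add]; simp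
  let e' : (X × Y) ≃L[ℝ] (X × Y) := ContinuousLinearEquiv.equivOfInverse (D 0)
    ((ContinuousLinearMap.fst ℝ X Y).prod (e.symm.toContinuousLinearMap.comp
      (ContinuousLinearMap.snd ℝ X Y - (fderiv ℝ Φ 0).comp
        ((ContinuousLinearMap.inl ℝ X Y).comp (ContinuousLinearMap.fst ℝ X Y)))))
    (fun p => by
      ext
      · simp [D]
      · simp [D, hdec p.1 p.2])
    (fun p => by
      ext
      · simp [D]
      · simp only [D, ContinuousLinearMap.prod_apply]
        rw [hdec]; simp)
  have hs : HasStrictFDerivAt Ψ (e' : X × Y →L[ℝ] X × Y) 0 := by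
    have := hΨ.contDiffAt.hasStrictFDerivAt (x := 0) (by simp)
    rwa [(hD 0).fderiv] at this
  let H := hs.toOpenPartialHomeomorph Ψ
  have hH : ∀ p, H p = Ψ p := fun p => rfl
  have hsrc : (0 : X × Y) ∈ H.source := hs.mem_toOpenPartialHomeomorph_source
  have hΨ0 : Ψ 0 = 0 := by simp [Ψ, h0]
  have hsymm0 : H.symm 0 = 0 := by
    have := H.left_inv hsrc
    rwa [hH, hΨ0] at this
  have htgt : (0 : X × Y) ∈ H.target := by
    have := H.map_source hsrc
    rwa [hH, hΨ0] at this
  have hinv : ∀ᶠ p in 𝓝 (0 : X × Y), ∃ e₁ : (X × Y) ≃L[ℝ] (X × Y),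
      (e₁ : X × Y →L[ℝ] X × Y) = D p := by
    have hc : Continuous D := by
      have : D = fderiv ℝ Ψ := funext fun p => (hD p).fderiv.symm
      rw [this]; exact hΨ.continuous_fderiv (by simp)
    exact hc.continuousAt.eventually (ContinuousLinearEquiv.nhds e')
  have hsm : ∀ᶠ a in 𝓝 (0 : X × Y), ContDiffAt ℝ ∞ H.symm a := by
    have hcs : Tendsto H.symm (𝓝 0) (𝓝 0) := by
      have := H.continuousAt_symm htgt
      rwa [ContinuousAt, hsymm0] at this
    filter_upwards [hcs.eventually hinv, H.open_target.mem_nhds htgt] with a ⟨e₁, h1⟩ h2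
    exact H.contDiffAt_symm h2 (f₀' := e₁) (by rw [h1]; exact hD _) hΨ.contDiffAt
  have hin : Tendsto (fun x : X => (x, (0 : Y))) (𝓝 0) (𝓝 0) :=
    Continuous.tendsto' (by fun_prop) _ _ rfl
  have hg : ∀ᶠ x in 𝓝 (0 : X), ContDiffAt ℝ ∞ (fun x => (H.symm (x, 0)).2) x := by
    filter_upwards [hin.eventually hsm] with x hx
    exact contDiffAt_snd.comp x (hx.comp x (contDiffAt_id.prodMk contDiffAt_const))
  have hz : ∀ᶠ x in 𝓝 (0 : X), Φ (x, (H.symm (x, 0)).2) = 0 := by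
    filter_upwards [hin.eventually (H.open_target.mem_nhds htgt)] with x hx
    have h1 := H.right_inv hx
    rw [hH] at h1
    have h2 : (H.symm (x, 0)).1 = x := congrArg Prod.fst h1
    have h3 : Φ (H.symm (x, 0)) = 0 := congrArg Prod.snd h1
    have h4 : (x, (H.symm (x, 0)).2) = H.symm (x, 0) := Prod.ext h2.symm rfl
    rw [h4, h3]
  refine ⟨fun x => (H.symm (x, 0)).2, by simp [← Prod.zero_eq_mk, hsymm0], hg, hz, ?_, ?_⟩
  · filter_upwards [H.open_source.mem_nhds hsrc] with p hp h
    have h1 := H.left_inv hp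
    rw [hH, show Ψ p = (p.1, 0) from Prod.ext rfl h] at h1
    rw [h1]
  · intro x hx
    set g := fun x => (H.symm (x, 0)).2
    have hg0 : g 0 = 0 := by simp [g, ← Prod.zero_eq_mk, hsymm0]
    have d1 : HasFDerivAt g (fderiv ℝ g 0) 0 :=
      (hg.self_of_nhds.differentiableAt (by simp)).hasFDerivAt
    have d2 : HasFDerivAt Φ (fderiv ℝ Φ 0) ((0 : X), g 0) := by
      rw [hg0]; exact (hΦ.differentiable (by simp) _).hasFDerivAt
    have d3 := d2.comp (0 : X) ((hasFDerivAt_id (𝕜 := ℝ) (0 : X)).prodMk d1)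
    have d4 : HasFDerivAt (fun x => Φ (x, g x)) (0 : X →L[ℝ] Y) 0 :=
      (hasFDerivAt_const (0 : Y) (0 : X)).congr_of_eventuallyEq hz
    have := congrArg (fun T => T x) (d3.unique d4)
    simp only [ContinuousLinearMap.comp_apply, ContinuousLinearMap.prod_apply] at this
    rw [hdec] at this
    simpa [hx] using this

end implicit

section core

set_option maxSynthPendingDepth 3
set_option linter.unusedSectionVars false

variable {E : Type} [NormedAddCommGroup E] [InnerProductSpace ℝ E] [FiniteDimensional ℝ E]

/-- The space of second order jets of functions on `E`. -/
abbrev Jet (E : Type) [NormedAddCommGroup E] [InnerProductSpace ℝ E] : Type :=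
  ℝ × (E →L[ℝ] ℝ) × (E →L[ℝ] E →L[ℝ] ℝ)

/-- The second order jet of `u` at `x`. -/
def jet (u : E → ℝ) (x : E) : Jet E := (u x, fderiv ℝ u x, fderiv ℝ (fderiv ℝ u) x)

variable [MeasurableSpace E] [BorelSpace E] [Nontrivial E]
  {Q : Type} [NormedAddCommGroup Q] [NormedSpace ℝ Q] [FiniteDimensional ℝ Q]

/-- Small solutions, depending on a parameter, of a nonlinear elliptic equation. -/
theorem exists_local_solutions {G : Q × E × Jet E → ℝ} (hG : ContDiff ℝ ∞ G)
    (L : (E →L[ℝ] E →L[ℝ] ℝ) →L[ℝ] ℝ) (hL : ∀ p : E →L[ℝ] ℝ, p ≠ 0 → 0 < L (tens p p))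
    (hG0 : ∀ y, G (0, y, 0) = 0)
    (hGL : ∀ y j, HasDerivAt (fun s : ℝ => G (0, y, s • j)) (L j.2.2) 0) :
    ∃ (w : Q → E → ℝ) (m : Q → Jet E), m 0 = 0 ∧ ContDiffAt ℝ ∞ m 0 ∧
      (∀ q, (∀ y, HasDerivAt (fun s : ℝ => G (s • q, y, 0)) 0 0) → fderiv ℝ m 0 q = 0) ∧
      (∀ q, jet (w q) 0 = m q) ∧
      ∀ᶠ q in 𝓝 0, ∀ᶠ y in 𝓝 0, ContDiffAt ℝ ∞ (w q) y ∧ G (q, y, jet (w q) y) = 0 := by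
  have hG1 : ContDiff ℝ 1 G := hG.of_le (by exact_mod_cast le_top)
  obtain ⟨ψ, ρ, hψ, hρ, hρ1, hψρ⟩ := exists_kernel L hL
  obtain ⟨χ, hχ, hχ1⟩ := exists_bump (E := E) 1
  obtain ⟨X, hX, hXt⟩ := hχ.exists_smooth_translate
  have hκ : IsKernel fun x : E => χ x • x := ⟨hχ.smooth.smul contDiff_id, hχ.supp.smul_right⟩
  obtain ⟨K, hK, hKt⟩ := hκ.exists_smooth_translate
  have hX0 : ∀ x, X 0 x = χ x := fun x => by simpa using hXt 0 (by simp) x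
  obtain ⟨C, hC, hsmall⟩ := exists_norm_mollify_mul_le hρ hχ hX0
  set T : ℝ := 1 + ‖mul (X 0)‖ * C with hT
  have hT1 : 1 ≤ T := le_add_of_nonneg_right (by positivity)
  have hT0 : 0 < T := by linarith
  obtain ⟨A₀, A₁, A₂, hA₀, hA₁, t₀, t₁, t₂, hAL⟩ := exists_potentials hψ hT0
  have hAL' := hAL L ρ hρ hρ1 hψρ
  -- the jet operator
  let A : Hol E ℝ →L[ℝ] Hol E (Jet E) :=
    (postcomp (ContinuousLinearMap.inl ℝ ℝ ((E →L[ℝ] ℝ) × (E →L[ℝ] E →L[ℝ] ℝ)))).comp A₀ +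
    (postcomp ((ContinuousLinearMap.inr ℝ ℝ ((E →L[ℝ] ℝ) × (E →L[ℝ] E →L[ℝ] ℝ))).comp
      (ContinuousLinearMap.inl ℝ (E →L[ℝ] ℝ) (E →L[ℝ] E →L[ℝ] ℝ)))).comp A₁ +
    (postcomp ((ContinuousLinearMap.inr ℝ ℝ ((E →L[ℝ] ℝ) × (E →L[ℝ] E →L[ℝ] ℝ))).comp
      (ContinuousLinearMap.inr ℝ (E →L[ℝ] ℝ) (E →L[ℝ] E →L[ℝ] ℝ)))).comp A₂
  have hA : ∀ f x, A f x = (A₀ f x, A₁ f x, A₂ f x) := fun f x => by simp [A]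
  have hjet : ∀ f x, jet (A₀ f) x = A f x := fun f x => by
    rw [hA, jet, show fderiv ℝ (A₀ f) = A₁ f from funext fun x => (hA₀ f x).fderiv,
      (hA₁ f x).fderiv]
  have hAt : ∀ t f, A (translate t f) = translate t (A f) := fun t f => by
    ext1 x; simp only [translate_apply, hA, t₀, t₁, t₂]
  -- the nonlinear operator
  let Arg : (Q × E) × Hol E ℝ → Hol E (Q × E × Jet E) := fun p =>
    const (p.1.1, 0, 0) + postcomp (ContinuousLinearMap.inr ℝ Q (E × Jet E))
      (postcomp (ContinuousLinearMap.inl ℝ E (Jet E)) (K p.1.2) +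
        postcomp (ContinuousLinearMap.inr ℝ E (Jet E)) (A (mul (X p.1.2) p.2)))
  have hArg : ∀ p x, Arg p x = (p.1.1, K p.1.2 x, A (mul (X p.1.2) p.2) x) := fun p x => by
    simp [Arg]
  have hArgS : ContDiff ℝ ∞ Arg := by
    have e1 : ContDiff ℝ ∞ fun p : (Q × E) × Hol E ℝ => K p.1.2 :=
      hK.comp (contDiff_snd.comp contDiff_fst)
    have e2 : ContDiff ℝ ∞ fun p : (Q × E) × Hol E ℝ => X p.1.2 :=
      hX.comp (contDiff_snd.comp contDiff_fst)
    have e3 : ContDiff ℝ ∞ fun p : (Q × E) × Hol E ℝ => mul (X p.1.2) p.2 :=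
      ((ContinuousLinearMap.contDiff _).comp e2).clm_apply contDiff_snd
    refine ((ContinuousLinearMap.contDiff _).comp ?_).add
      ((ContinuousLinearMap.contDiff _).comp (((ContinuousLinearMap.contDiff _).comp e1).add
        ((ContinuousLinearMap.contDiff _).comp ((ContinuousLinearMap.contDiff _).comp e3))))
    exact (contDiff_fst.comp contDiff_fst).prodMk contDiff_const
  let Φ : (Q × E) × Hol E ℝ → Hol E ℝ := fun p =>
    p.2 - mul (X p.1.2) (mul (X p.1.2) p.2) - mul (X p.1.2) (comp G (Arg p))
  have hΦa : ∀ p x, Φ p x = p.2 x - X p.1.2 x * (X p.1.2 x * p.2 x) -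
      X p.1.2 x * G (p.1.1, K p.1.2 x, A (mul (X p.1.2) p.2) x) := fun p x => by
    simp [Φ, comp_apply hG1, hArg]
  have hΦ : ContDiff ℝ ∞ Φ := by
    have e2 : ContDiff ℝ ∞ fun p : (Q × E) × Hol E ℝ => mul (X p.1.2) :=
      (ContinuousLinearMap.contDiff _).comp (hX.comp (contDiff_snd.comp contDiff_fst))
    exact (contDiff_snd.sub (e2.clm_apply (e2.clm_apply contDiff_snd))).sub
      (e2.clm_apply ((contDiff_comp hG).comp hArgS))
  have hΦ0 : Φ 0 = 0 := by
    ext1 x; rw [hΦa]; simp [hG0]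
  -- directional derivatives at the origin
  have hdir : ∀ (v : (Q × E) × Hol E ℝ) x (d : ℝ), HasDerivAt (fun s : ℝ => Φ (s • v) x) d 0 →
      fderiv ℝ Φ 0 v x = d := fun v x d hd => by
    have h1 : HasDerivAt (fun s : ℝ => s • v) v 0 := by
      simpa using (hasDerivAt_id (0 : ℝ)).smul_const v
    have h2 : HasFDerivAt Φ (fderiv ℝ Φ 0) ((0 : ℝ) • v) := by
      rw [zero_smul]; exact (hΦ.differentiable (by simp) 0).hasFDerivAt
    have h3 := (eval x).hasFDerivAt.comp_hasDerivAt (0 : ℝ) (h2.comp_hasDerivAt (0 : ℝ) h1)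
    exact h3.unique hd
  let M : Hol E ℝ →L[ℝ] Hol E ℝ := (postcomp L).comp A₂ + ContinuousLinearMap.id ℝ _
  have hM : ∀ f x, M f x = mollify ρ f T x := fun f x => by simp [M, hAL']
  let R : Hol E ℝ →L[ℝ] Hol E ℝ := (mul (X 0)).comp (M.comp (mul (X 0)))
  have hR : ‖R‖ < 1 := by
    have h1 : ‖M.comp (mul (X 0))‖ ≤ C * T⁻¹ :=
      ContinuousLinearMap.opNorm_le_bound _ (by positivity) fun f =>
        hsmall T hT1 f _ fun x => hM _ _
    calc ‖R‖ ≤ ‖mul (X 0)‖ * ‖M.comp (mul (X 0))‖ := ContinuousLinearMap.opNorm_comp_le _ _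
      _ ≤ ‖mul (X 0)‖ * (C * T⁻¹) := by gcongr
      _ = (‖mul (X 0)‖ * C) / T := by ring
      _ < 1 := by rw [div_lt_one hT0, hT]; linarith
  let e : Hol E ℝ ≃L[ℝ] Hol E ℝ := ContinuousLinearEquiv.unitsEquiv ℝ _ (Units.oneSub R hR)
  have he : ∀ f, e f = f - R f := fun f => rfl
  have heΦ : ∀ f, fderiv ℝ Φ 0 (0, f) = e f := fun f => by
    ext1 x
    refine hdir _ x _ ?_
    have h1 := hGL (K 0 x) (A (mul (X 0) f) x)
    have h2 := (((hasDerivAt_id (0 : ℝ)).mul_const (f x - X 0 x * (X 0 x * f x)))).sub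
      (h1.const_mul (X 0 x))
    refine (h2.congr_deriv ?_).congr_of_eventuallyEq (Eventually.of_forall fun s => ?_)
    · rw [he, hA]
      simp only [sub_apply, R, ContinuousLinearMap.comp_apply, mul_apply, hM, hAL']
      ring
    · simp [hΦa]
      ring
  obtain ⟨g, hg0, hgS, hgz, hgu, hgd⟩ := exists_implicit hΦ hΦ0 e heΦ
  have hin : Tendsto (fun q : Q => (q, (0 : E))) (𝓝 0) (𝓝 0) :=
    Continuous.tendsto' (by fun_prop) _ _ rfl
  let m : Q → Jet E := fun q => eval 0 (A (mul (X 0) (g (q, 0))))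
  have hg00 : g (0, 0) = 0 := hg0
  have hgS0 : ContDiffAt ℝ ∞ g (0, 0) := hgS.self_of_nhds
  refine ⟨fun q => A₀ (mul (X 0) (g (q, 0))), m, by simp [m, hg00], ?_, fun q hq => ?_,
    fun q => hjet _ _, ?_⟩
  · exact ((eval 0).contDiff.comp (A.contDiff.comp (mul (X 0)).contDiff)).contDiffAt.comp (0 : Q)
      (hgS0.comp (0 : Q) (contDiffAt_id.prodMk contDiffAt_const))
  · have h1 : fderiv ℝ Φ 0 ((q, 0), 0) = 0 := by
      ext1 x
      refine hdir _ x _ ?_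
      have h2 := (hq (K 0 x)).const_mul (-X 0 x)
      simp only [mul_zero] at h2
      refine h2.congr_of_eventuallyEq (Eventually.of_forall fun s => ?_)
      simp [hΦa]
    have h3 := hgd _ h1
    have h4 : HasFDerivAt g (fderiv ℝ g 0) ((fun q : Q => (q, (0 : E))) 0) :=
      (hgS0.differentiableAt (by simp)).hasFDerivAt
    have h5 : HasFDerivAt (fun q : Q => (q, (0 : E))) (ContinuousLinearMap.inl ℝ Q E) 0 :=
      hasFDerivAt_prodMk_left 0 0
    have h6 := ((eval (0 : E)).comp (A.comp (mul (X 0)))).hasFDerivAt.comp (0 : Q)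
      (h4.comp (0 : Q) h5)
    have h7 : fderiv ℝ m 0 = _ := h6.fderiv
    rw [h7]
    simp only [ContinuousLinearMap.comp_apply, ContinuousLinearMap.inl_apply, h3, map_zero]
  · obtain ⟨δ, hδ, hball⟩ := Metric.eventually_nhds_iff_ball.1 hgu
    obtain ⟨δ', hδ', hball'⟩ := Metric.eventually_nhds_iff_ball.1 hgS
    have hsmallg : ∀ᶠ q in 𝓝 (0 : Q), ‖g (q, 0)‖ < δ := by
      have : Tendsto (fun q => g (q, 0)) (𝓝 0) (𝓝 0) := by
        have h1 := hgS0.continuousAt.tendsto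
        rw [hg00] at h1
        exact h1.comp hin
      simpa using this.eventually (Metric.ball_mem_nhds 0 hδ)
    filter_upwards [hsmallg, hin.eventually hgz, Metric.ball_mem_nhds (0 : Q) hδ,
      Metric.ball_mem_nhds (0 : Q) hδ'] with q h1 h2 h3 h4
    have hball1 : Metric.ball (0 : E) (min 1 (min δ δ')) ∈ 𝓝 0 :=
      Metric.ball_mem_nhds _ (by positivity)
    rw [mem_ball_zero_iff] at h3 h4
    have htr : ∀ t ∈ Metric.ball (0 : E) (min 1 (min δ δ')),
        translate t (g (q, 0)) = g (q, t) := fun t ht => by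
      rw [mem_ball_zero_iff, lt_min_iff, lt_min_iff] at ht
      have hXtr : ∀ f, mul (X t) (translate t f) = translate t (mul (X 0) f) := fun f => by
        ext1 x; simp [hXt t ht.1, hX0]
      have := hball ((q, t), translate t (g (q, 0))) ?_ ?_
      · exact this
      · rw [mem_ball_zero_iff, Prod.norm_def, Prod.norm_def]
        exact max_lt (max_lt h3 ht.2.1) ((norm_translate_le _ _).trans_lt h1)
      · ext1 x
        have h5 := congrArg (fun f : Hol E ℝ => f (x + t)) h2
        simp only [hΦa, zero_apply] at h5 ⊢
        rw [hXtr, hAt]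
        simp only [translate_apply]
        rw [hXt t ht.1, hKt t ht.1, ← h5, hX0]
        have h6 := hKt 0 (by simp) (x + t)
        rw [add_zero] at h6
        rw [h6]
    filter_upwards [hball1, eventually_mem_nhds_iff.2 hball1] with y hy hyn
    refine ⟨?_, ?_⟩
    · have e1 : (A₀ (mul (X 0) (g (q, 0))) : E → ℝ) =ᶠ[𝓝 y]
          fun t => eval 0 (A₀ (mul (X t) (g (q, t)))) := by
        filter_upwards [hyn] with t ht
        have h7 : mul (X t) (g (q, t)) = translate t (mul (X 0) (g (q, 0))) := by
          rw [← htr t ht]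
          ext1 x
          rw [mem_ball_zero_iff, lt_min_iff] at ht
          simp [hXt t ht.1, hX0]
        rw [h7, eval_apply, t₀, zero_add]
      refine ContDiffAt.congr_of_eventuallyEq ?_ e1
      refine ((eval 0).comp A₀).contDiff.contDiffAt.comp y ?_
      refine (mul.contDiff.comp hX).contDiffAt.clm_apply ?_
      have : ContDiffAt ℝ ∞ g (q, y) := hball' _ (by
        rw [mem_ball_zero_iff, lt_min_iff, lt_min_iff] at hy
        rw [mem_ball_zero_iff, Prod.norm_def]
        exact max_lt h4 hy.2.2)
      exact this.comp y (contDiffAt_const.prodMk contDiffAt_id)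
    · have h5 := congrArg (fun f : Hol E ℝ => f y) h2
      simp only [hΦa, zero_apply] at h5
      rw [mem_ball_zero_iff, lt_min_iff] at hy
      have h6 := hKt 0 (by simp) y
      simp only [add_zero, hχ1 y hy.1.le, one_smul] at h6
      rw [h6, hX0, hχ1 y hy.1.le] at h5
      rw [hjet]
      linarith

end core

section jets

set_option maxSynthPendingDepth 3

variable {E : Type} [NormedAddCommGroup E] [InnerProductSpace ℝ E]

lemma jet_add {f g : E → ℝ} {x : E} (hf : ContDiffAt ℝ 2 f x) (hg : ContDiffAt ℝ 2 g x) :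
    jet (fun y => f y + g y) x = jet f x + jet g x := by
  have h1 : fderiv ℝ (fun y => f y + g y) =ᶠ[𝓝 x] fun y => fderiv ℝ f y + fderiv ℝ g y := by
    filter_upwards [hf.eventually (by simp), hg.eventually (by simp)] with y h1 h2
    exact fderiv_fun_add (h1.differentiableAt (by simp)) (h2.differentiableAt (by simp))
  simp only [jet, h1.fderiv_eq, h1.eq_of_nhds]
  rw [fderiv_fun_add ((hf.fderiv_right (m := 1) (by norm_num)).differentiableAt (by simp))
    ((hg.fderiv_right (m := 1) (by norm_num)).differentiableAt (by simp))]
  rfl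

/-- The effect on second order jets of the rescaling `w ↦ ε ^ 2 * w (ε⁻¹ • ·)`. -/
def scale (ε : ℝ) (j : Jet E) : Jet E := (ε ^ 2 * j.1, ε • j.2.1, j.2.2)

lemma jet_rescale {ε : ℝ} (hε : ε ≠ 0) (w : E → ℝ) (x : E) :
    jet (fun x => ε ^ 2 * w (ε⁻¹ • x)) x = scale ε (jet w (ε⁻¹ • x)) := by
  have h : ∀ x, fderiv ℝ (fun x => ε ^ 2 * w (ε⁻¹ • x)) x = ε • fderiv ℝ w (ε⁻¹ • x) := by
    intro x
    rw [show (fun x => ε ^ 2 * w (ε⁻¹ • x)) = (ε ^ 2) • (fun x => w (ε⁻¹ • x)) from rfl,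
      fderiv_const_smul_field, Pi.smul_apply, fderiv_comp_smul, smul_smul]
    congr 1; field_simp
  have h2 : fderiv ℝ (fun x => ε • fderiv ℝ w (ε⁻¹ • x)) x =
      fderiv ℝ (fderiv ℝ w) (ε⁻¹ • x) := by
    rw [show (fun x => ε • fderiv ℝ w (ε⁻¹ • x)) = ε • (fun x => fderiv ℝ w (ε⁻¹ • x)) from rfl,
      fderiv_const_smul_field, Pi.smul_apply, fderiv_comp_smul, smul_smul, mul_inv_cancel₀ hε,
      one_smul]
  rw [jet, funext h, h2]
  rfl

/-- The quadratic polynomial with jet `j` at the origin. -/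
def quad (j : Jet E) (x : E) : ℝ := j.1 + j.2.1 x + 2⁻¹ * j.2.2 x x

/-- The jets of a quadratic polynomial. -/
def quadJet (j : Jet E) (x : E) : Jet E := (quad j x, j.2.1 + j.2.2 x, j.2.2)

lemma contDiff_quad (j : Jet E) : ContDiff ℝ ∞ (quad j) := by
  unfold quad
  fun_prop

lemma jet_quad {j : Jet E} (hj : ∀ x y, j.2.2 x y = j.2.2 y x) (x : E) :
    jet (quad j) x = quadJet j x := by
  have h : ∀ x, HasFDerivAt (quad j) (j.2.1 + j.2.2 x) x := fun x => by
    have := ((j.2.1.hasFDerivAt (x := x)).const_add j.1).add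
      (((j.2.2.hasFDerivAt (x := x)).clm_apply (hasFDerivAt_id x)).const_mul 2⁻¹)
    refine this.congr_fderiv ?_
    ext y
    simp [hj y x]
    ring
  rw [jet, show fderiv ℝ (quad j) = fun x => j.2.1 + j.2.2 x from funext fun x => (h x).fderiv,
    ((j.2.2.hasFDerivAt (x := x)).const_add j.2.1).fderiv]
  rfl

@[simp] lemma quadJet_zero (j : Jet E) : quadJet j 0 = j := by
  simp [quadJet, quad]

end jets

section solve

set_option maxSynthPendingDepth 3
set_option linter.unusedSectionVars false

variable {E : Type} [NormedAddCommGroup E] [InnerProductSpace ℝ E] [FiniteDimensional ℝ E]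
  [MeasurableSpace E] [BorelSpace E] [Nontrivial E]
  {P : Type} [NormedAddCommGroup P] [NormedSpace ℝ P] [FiniteDimensional ℝ P]

theorem exists_solution_of_pos {F : E × P → ℝ} (hF : ContDiff ℝ ∞ F) {p₀ : P}
    (h0 : F (0, p₀) = 0) (ℓ : Jet E →L[ℝ] P) (sec : P →L[ℝ] Jet E) (hsec : ∀ p, ℓ (sec p) = p)
    (hsymm : ∀ p x y, (sec p).2.2 x y = (sec p).2.2 y x)
    (hpos : ∀ p : E →L[ℝ] ℝ, p ≠ 0 → 0 < fderiv ℝ F (0, p₀) (0, ℓ (0, 0, tens p p))) :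
    ∃ u : E → ℝ, (∀ᶠ x in 𝓝 0, ContDiffAt ℝ ∞ u x ∧ F (x, ℓ (jet u x)) = 0) ∧
      ℓ (jet u 0) = p₀ := by
  let c : P →L[ℝ] ℝ := (fderiv ℝ F (0, p₀)).comp (ContinuousLinearMap.inr ℝ E P)
  have hc : ∀ p, HasDerivAt (fun s : ℝ => F (0, p₀ + s • p)) (c p) 0 := fun p => by
    have h1 : HasFDerivAt F (fderiv ℝ F (0, p₀)) (0, p₀ + (0 : ℝ) • p) := by
      simpa using (hF.differentiable (by simp) (0, p₀)).hasFDerivAt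
    have h2 : HasDerivAt (fun s : ℝ => ((0 : E), p₀ + s • p)) (0, (1 : ℝ) • p) 0 :=
      (hasDerivAt_const _ _).prodMk (((hasDerivAt_id (0 : ℝ)).smul_const p).const_add p₀)
    exact (h1.comp_hasDerivAt (0 : ℝ) h2).congr_deriv (by simp [c])
  obtain ⟨e, he⟩ : ∃ e, c e = 1 := by
    obtain ⟨x, hx⟩ := exists_ne (0 : E)
    have hp : innerSL ℝ x ≠ 0 := fun h => hx (by
      simpa using congrArg (fun f : E →L[ℝ] ℝ => f x) h)
    have := hpos _ hp
    refine ⟨(c (ℓ (0, 0, tens (innerSL ℝ x) (innerSL ℝ x))))⁻¹ •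
      ℓ (0, 0, tens (innerSL ℝ x) (innerSL ℝ x)), ?_⟩
    rw [map_smul, smul_eq_mul, inv_mul_cancel₀]
    exact this.ne'
  let pr : P →L[ℝ] P := ContinuousLinearMap.id ℝ P - c.smulRight e
  have hpr : ∀ p, pr p = p - c p • e := fun p => by simp [pr]
  have hcpr : ∀ p, c (pr p) = 0 := fun p => by simp [hpr, he]
  have hprpr : ∀ p, pr (pr p) = pr p := fun p => by rw [hpr (pr p), hcpr]; simp
  let G : (ℝ × P) × E × Jet E → ℝ := fun z =>
    F (z.1.1 • z.2.1, ℓ (quadJet (sec (p₀ + pr z.1.2)) (z.1.1 • z.2.1)) + ℓ (scale z.1.1 z.2.2))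
  have hG : ContDiff ℝ ∞ G := by
    simp only [G, quadJet, quad, scale]
    fun_prop
  let L : (E →L[ℝ] E →L[ℝ] ℝ) →L[ℝ] ℝ := c.comp (ℓ.comp
    ((ContinuousLinearMap.inr ℝ ℝ ((E →L[ℝ] ℝ) × (E →L[ℝ] E →L[ℝ] ℝ))).comp
      (ContinuousLinearMap.inr ℝ (E →L[ℝ] ℝ) (E →L[ℝ] E →L[ℝ] ℝ))))
  have hLB : ∀ B, L B = c (ℓ (0, 0, B)) := fun B => rfl
  obtain ⟨w, m, hm0, hm, hm1, hwm, hw⟩ := exists_local_solutions hG L (fun p hp => hpos p hp)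
    (fun y => by simp [G, scale, hsec, h0, ← Prod.zero_eq_mk])
    (fun y j => by
      refine ((hc (ℓ (0, 0, j.2.2))).congr_of_eventuallyEq (Eventually.of_forall fun s => ?_))
      have : scale 0 (s • j) = s • ((0, 0, j.2.2) : Jet E) := by
        simp [scale]
      have h2 : ℓ (scale 0 (s • j)) = s • ℓ (0, 0, j.2.2) := by rw [this, map_smul]
      simp only [G, Prod.fst_zero, Prod.snd_zero, h2, zero_smul, map_zero, add_zero, quadJet_zero, hsec])
  have hm1' : ∀ p : P, fderiv ℝ m 0 (0, p) = 0 := fun p => by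
    refine hm1 _ fun y => ?_
    refine ((hc (pr p)).congr_deriv (hcpr p)).congr_of_eventuallyEq
      (Eventually.of_forall fun s => ?_)
    simp [G, hsec, scale, ← Prod.zero_eq_mk]
  let V : ℝ × P → P := fun q => pr q.2 + ℓ (scale q.1 (m q))
  have hV : ContDiffAt ℝ ∞ V 0 := by
    simp only [V, scale]
    fun_prop
  let N : ℝ × P → P := fun q => pr (V q) + c q.2 • e
  have hN : ContDiffAt ℝ ∞ N 0 := by
    simp only [N]
    fun_prop
  have hV0 : V 0 = 0 := by simp [V, hm0, scale, ← Prod.zero_eq_mk]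
  have hN0 : N 0 = 0 := by simp [N, hV0]
  have hNd : (fderiv ℝ N 0).comp (ContinuousLinearMap.inr ℝ ℝ P) =
      ContinuousLinearMap.id ℝ P := by
    have hi : HasFDerivAt (fun p : P => ((0 : ℝ), p)) (ContinuousLinearMap.inr ℝ ℝ P) 0 :=
      (ContinuousLinearMap.inr ℝ ℝ P).hasFDerivAt
    have h1 : HasFDerivAt (fun p : P => N (0, p))
        ((fderiv ℝ N 0).comp (ContinuousLinearMap.inr ℝ ℝ P)) 0 :=
      HasFDerivAt.comp (f := fun p : P => ((0 : ℝ), p)) (0 : P)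
        (hN.differentiableAt (by simp)).hasFDerivAt hi
    have h2 : HasFDerivAt (fun p : P => m (0, p)) (0 : P →L[ℝ] Jet E) 0 := by
      refine (HasFDerivAt.comp (f := fun p : P => ((0 : ℝ), p)) (0 : P)
        (hm.differentiableAt (by simp)).hasFDerivAt hi).congr_fderiv ?_
      ext1 p
      exact hm1' p
    let T : Jet E →L[ℝ] P := ℓ.comp
      (((ContinuousLinearMap.inr ℝ ℝ ((E →L[ℝ] ℝ) × (E →L[ℝ] E →L[ℝ] ℝ))).comp
      (ContinuousLinearMap.inr ℝ (E →L[ℝ] ℝ) (E →L[ℝ] E →L[ℝ] ℝ))).comp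
      ((ContinuousLinearMap.snd ℝ (E →L[ℝ] ℝ) (E →L[ℝ] E →L[ℝ] ℝ)).comp
      (ContinuousLinearMap.snd ℝ ℝ ((E →L[ℝ] ℝ) × (E →L[ℝ] E →L[ℝ] ℝ)))))
    have hT : ∀ j, T j = ℓ (scale 0 j) := fun j => by simp [T, scale]
    have h3 := ((pr.hasFDerivAt (x := (0 : P))).add
      ((pr.comp T).hasFDerivAt.comp (0 : P) h2)).add ((c.smulRight e).hasFDerivAt (x := (0 : P)))
    refine h1.unique ((h3.congr_fderiv ?_).congr_of_eventuallyEq (Eventually.of_forall fun p => ?_))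
    · ext p; simp [pr]
    · simp [N, V, hT, hprpr]
  have hinv : (fderiv ℝ N ((0 : ℝ), (0 : P)) ∘L .inr ℝ ℝ P).IsInvertible :=
    ⟨ContinuousLinearEquiv.refl ℝ P, hNd.symm⟩
  have hN' : ContDiffAt ℝ ∞ N ((0 : ℝ), (0 : P)) := hN
  let ϖ : ℝ → P := hN'.implicitFunction (by simp) hinv
  have hϖ0 : ϖ 0 = 0 := hN'.implicitFunction_apply_self (by simp) hinv
  have hϖN : ∀ᶠ ε in 𝓝 (0 : ℝ), N (ε, ϖ ε) = 0 := by
    filter_upwards [hN'.eventually_apply_implicitFunction (by simp) hinv] with ε h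
    exact h.trans hN0
  have hϖc : ContinuousAt ϖ 0 :=
    (hN'.contDiffAt_implicitFunction (by simp) hinv).continuousAt
  have hqc : ContinuousAt (fun ε => (ε, ϖ ε)) (0 : ℝ) := continuousAt_id.prodMk hϖc
  have hq : Tendsto (fun ε => (ε, ϖ ε)) (𝓝 (0 : ℝ)) (𝓝 0) := by
    have := hqc.tendsto
    rwa [hϖ0] at this
  have hcV : Tendsto (fun ε => c (V (ε, ϖ ε))) (𝓝 (0 : ℝ)) (𝓝 0) := by
    have h1 : Tendsto (fun q => c (V q)) (𝓝 0) (𝓝 (c (V 0))) :=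
      (c.continuous.continuousAt.comp hV.continuousAt).tendsto
    rw [hV0, map_zero] at h1
    exact h1.comp hq
  have hne : ∀ᶠ s in 𝓝 (0 : ℝ), F (0, p₀ + s • e) = 0 → s = 0 := by
    have := (hc e).eventually_ne (c := 0) (by rw [he]; exact one_ne_zero)
    rw [eventually_nhdsWithin_iff] at this
    filter_upwards [this] with s hs h
    by_contra h'
    exact hs h' h
  obtain ⟨ε, ⟨hwε, hNε, hneε⟩, hε⟩ := (((hq.eventually hw).and
    (hϖN.and (hcV.eventually hne))).filter_mono
      (nhdsWithin_le_nhds (s := {(0 : ℝ)}ᶜ))).and self_mem_nhdsWithin |>.exists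
  have hε : ε ≠ 0 := hε
  set q : ℝ × P := (ε, ϖ ε) with hqdef
  have hcq : c (ϖ ε) = 0 := by
    have := congrArg c hNε
    simpa [N, hcpr, he, hqdef] using this
  have hVe : V q = c (V q) • e := by
    have h1 : pr (V q) = 0 := by simpa [N, hqdef, hcq] using hNε
    rw [hpr, sub_eq_zero] at h1
    exact h1
  have hVz : V q = 0 := by
    have h1 : F (0, p₀ + V q) = 0 := by
      have := hwε.self_of_nhds.2
      rw [hwm] at this
      simpa [G, V, hsec, hqdef, add_assoc] using this
    rw [hVe] at h1
    rw [hVe, hneε h1, zero_smul]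
  set J : Jet E := sec (p₀ + pr (ϖ ε)) with hJ
  have hsc : Tendsto (fun x : E => ε⁻¹ • x) (𝓝 0) (𝓝 0) := by
    have := (continuous_const_smul (T := E) ε⁻¹).tendsto 0
    rwa [smul_zero] at this
  have hju : ∀ x, ContDiffAt ℝ ∞ (w q) (ε⁻¹ • x) →
      ContDiffAt ℝ ∞ (fun x => quad J x + ε ^ 2 * w q (ε⁻¹ • x)) x ∧
      jet (fun x => quad J x + ε ^ 2 * w q (ε⁻¹ • x)) x =
        quadJet J x + scale ε (jet (w q) (ε⁻¹ • x)) := fun x hx => by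
    have h1 : ContDiffAt ℝ ∞ (fun x => ε ^ 2 * w q (ε⁻¹ • x)) x :=
      contDiffAt_const.mul (hx.comp x (contDiffAt_id.const_smul ε⁻¹))
    refine ⟨(contDiff_quad J).contDiffAt.add h1, ?_⟩
    have h2 : (2 : WithTop ℕ∞) ≤ (⊤ : ℕ∞) :=
      WithTop.coe_le_coe.2 (le_top : (2 : ℕ∞) ≤ ⊤)
    rw [jet_add ((contDiff_quad J).contDiffAt.of_le h2) (h1.of_le h2),
      jet_quad (hsymm _), jet_rescale hε]
  refine ⟨fun x => quad J x + ε ^ 2 * w q (ε⁻¹ • x), ?_, ?_⟩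
  · filter_upwards [hsc.eventually hwε] with x hx
    obtain ⟨h1, h2⟩ := hju x hx.1
    refine ⟨h1, ?_⟩
    have h3 := hx.2
    simp only [G, hqdef, smul_smul, mul_inv_cancel₀ hε, one_smul] at h3
    rw [h2, map_add]
    exact h3
  · have h1 : ContDiffAt ℝ ∞ (w q) (ε⁻¹ • (0 : E)) := by
      rw [smul_zero]; exact hwε.self_of_nhds.1
    rw [(hju 0 h1).2, map_add, smul_zero, hwm, quadJet_zero, hJ, hsec, add_assoc]
    exact (congrArg (p₀ + ·) hVz).trans (add_zero p₀)

/-- A quadratic form without real zeros among the covectors has a constant sign. -/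
theorem pos_or_neg_of_ne_zero (L : (E →L[ℝ] E →L[ℝ] ℝ) →L[ℝ] ℝ)
    (hL : ∀ p : E →L[ℝ] ℝ, p ≠ 0 → L (tens p p) ≠ 0) :
    (∀ p : E →L[ℝ] ℝ, p ≠ 0 → 0 < L (tens p p)) ∨ ∀ p : E →L[ℝ] ℝ, p ≠ 0 → L (tens p p) < 0 := by
  by_contra! h
  obtain ⟨⟨p, hp, hp'⟩, q, hq, hq'⟩ := h
  have hp1 := lt_of_le_of_ne hp' (hL p hp)
  have hq1 := lt_of_le_of_ne hq' (hL q hq).symm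
  have hexp : ∀ s : ℝ, L (tens (p + s • q) (p + s • q)) =
      L (tens q q) * (s * s) + (L (tens p q) + L (tens q p)) * s + L (tens p p) := fun s => by
    have : tens (p + s • q) (p + s • q) =
        (s * s) • tens q q + (s • tens p q + s • tens q p) + tens p p := by
      ext x y
      simp [tens_apply]
      ring
    rw [this]
    simp only [map_add, map_smul, smul_eq_mul]
    ring
  obtain ⟨s, hs⟩ := exists_quadratic_eq_zero (a := L (tens q q))
    (b := L (tens p q) + L (tens q p)) (c := L (tens p p)) hq1.ne'
    ⟨√(discrim _ _ _), (Real.mul_self_sqrt (by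
      rw [discrim]; nlinarith [sq_nonneg (L (tens p q) + L (tens q p)), mul_pos hq1 (neg_pos.2 hp1)])).symm⟩
  rw [← hexp] at hs
  have h0 : p = (-s) • q := by
    rw [neg_smul, ← add_eq_zero_iff_eq_neg]
    by_contra h
    exact hL _ h hs
  have : L (tens p p) = s ^ 2 * L (tens q q) := by
    have : tens p p = (s ^ 2) • tens q q := by
      rw [h0]; ext x y; simp [tens_apply]; ring
    rw [this, map_smul, smul_eq_mul]
  nlinarith [mul_nonneg (sq_nonneg s) hq1.le]

/-- Local solvability of elliptic equations of second order with prescribed jet at the origin. -/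
theorem exists_solution {F : E × P → ℝ} (hF : ContDiff ℝ ∞ F) {p₀ : P}
    (h0 : F (0, p₀) = 0) (ℓ : Jet E →L[ℝ] P) (sec : P →L[ℝ] Jet E) (hsec : ∀ p, ℓ (sec p) = p)
    (hsymm : ∀ p x y, (sec p).2.2 x y = (sec p).2.2 y x)
    (hell : ∀ p : E →L[ℝ] ℝ, p ≠ 0 → fderiv ℝ F (0, p₀) (0, ℓ (0, 0, tens p p)) ≠ 0) :
    ∃ u : E → ℝ, (∀ᶠ x in 𝓝 0, ContDiffAt ℝ ∞ u x ∧ F (x, ℓ (jet u x)) = 0) ∧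
      ℓ (jet u 0) = p₀ := by
  let L : (E →L[ℝ] E →L[ℝ] ℝ) →L[ℝ] ℝ := ((fderiv ℝ F (0, p₀)).comp
    (ContinuousLinearMap.inr ℝ E P)).comp (ℓ.comp
    ((ContinuousLinearMap.inr ℝ ℝ ((E →L[ℝ] ℝ) × (E →L[ℝ] E →L[ℝ] ℝ))).comp
      (ContinuousLinearMap.inr ℝ (E →L[ℝ] ℝ) (E →L[ℝ] E →L[ℝ] ℝ))))
  rcases pos_or_neg_of_ne_zero L hell with h | h
  · exact exists_solution_of_pos hF h0 ℓ sec hsec hsymm h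
  · obtain ⟨u, hu, hu0⟩ := exists_solution_of_pos (F := fun z => -F z) hF.neg (p₀ := p₀)
      (by simp [h0]) ℓ sec hsec hsymm fun p hp => by
        rw [fderiv_fun_neg]
        exact neg_pos.2 (h p hp)
    exact ⟨u, hu.mono fun x hx => ⟨hx.1, neg_eq_zero.1 hx.2⟩, hu0⟩

end solve

end Hol

end

section multiIndex

set_option maxSynthPendingDepth 3

open Hol

variable {n : ℕ}

/-- The sorted list of indices in which `i` occurs `α i` times. -/
def MI.idx (α : Fin n → ℕ) : List (Fin n) :=
  ((List.finRange n).map fun i => List.replicate (α i) i).flatten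

lemma MI.foldr_idx {M : Type*} (α : Fin n → ℕ) (f : Fin n → M → M) (a : M) :
    (MI.idx α).foldr f a =
      (List.ofFn (fun i : Fin n => (f i)^[α i])).foldr (· ∘ ·) id a := by
  have hrep : ∀ (k : ℕ) (i : Fin n) (b : M), (List.replicate k i).foldr f b = (f i)^[k] b := by
    intro k i b
    induction k with
    | zero => rfl
    | succ k ih => rw [List.replicate_succ, List.foldr_cons, ih, Function.iterate_succ_apply']
  rw [MI.idx, List.ofFn_eq_map]
  induction List.finRange n with
  | nil => rfl
  | cons i l ih =>
    rw [List.map_cons, List.flatten_cons, List.foldr_append, ih, hrep]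
    rfl

lemma MI.length_idx (α : Fin n → ℕ) : (MI.idx α).length = ∑ i, α i := by
  rw [MI.idx, List.length_flatten, List.map_map, ← List.ofFn_eq_map, List.sum_ofFn]
  simp

lemma MI.count_idx (α : Fin n → ℕ) (i : Fin n) : (MI.idx α).count i = α i := by
  rw [MI.idx, List.count_flatten, List.map_map, ← List.ofFn_eq_map, List.sum_ofFn]
  simp [List.count_replicate]

lemma MI.prod_idx (α : Fin n → ℕ) (ξ : Fin n → ℝ) :
    ((MI.idx α).map ξ).prod = ∏ i, ξ i ^ α i := by
  rw [MI.idx, List.map_flatten, List.prod_flatten, List.map_map, List.map_map, ← List.ofFn_eq_map,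
    List.prod_ofFn]
  simp

/-- The multi-index of the monomial `∏ i ∈ l, ξ i`. -/
def MI.ofList (l : List (Fin n)) (hl : l.length ≤ 2) : MI n :=
  ⟨fun i => l.count i, by
    have := Multiset.sum_count_eq_card (s := Finset.univ) (m := (l : Multiset (Fin n)))
      fun _ _ => Finset.mem_univ _
    simpa using this.trans_le hl⟩

lemma MI.ofList_idx (α : MI n) (h : (MI.idx α.1).length ≤ 2) : MI.ofList (MI.idx α.1) h = α :=
  Subtype.ext (funext fun i => MI.count_idx α.1 i)

/-- The value of the partial derivatives along `l` of a function with second order jet `j`. -/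
def jetEval (j : Jet (Euc n)) : List (Fin n) → ℝ
  | [] => j.1
  | [i] => j.2.1 (EuclideanSpace.single i 1)
  | [i, k] => j.2.2 (EuclideanSpace.single i 1) (EuclideanSpace.single k 1)
  | _ => 0

lemma jetEval_add (j j' : Jet (Euc n)) (l : List (Fin n)) :
    jetEval (j + j') l = jetEval j l + jetEval j' l := by
  rcases l with - | ⟨i, - | ⟨k, - | ⟨m, l⟩⟩⟩ <;> simp [jetEval]

lemma jetEval_smul (a : ℝ) (j : Jet (Euc n)) (l : List (Fin n)) :
    jetEval (a • j) l = a • jetEval j l := by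
  rcases l with - | ⟨i, - | ⟨k, - | ⟨m, l⟩⟩⟩ <;> simp [jetEval]

/-- The coordinates, indexed by multi-indices, of a jet. -/
def jetCoord (n : ℕ) : Jet (Euc n) →L[ℝ] (MI n → ℝ) :=
  LinearMap.toContinuousLinearMap
    { toFun := fun j α => jetEval j (MI.idx α.1)
      map_add' := fun j j' => funext fun _ => jetEval_add j j' _
      map_smul' := fun a j => funext fun _ => jetEval_smul a j _ }

lemma jetCoord_apply (j : Jet (Euc n)) (α : MI n) :
    jetCoord n j α = jetEval j (MI.idx α.1) := rfl

/-- The symmetric jet with given coordinates. -/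
def jetOfCoord (n : ℕ) : (MI n → ℝ) →L[ℝ] Jet (Euc n) :=
  LinearMap.toContinuousLinearMap
    { toFun := fun p => (p (MI.ofList [] (by simp)),
        ∑ i, p (MI.ofList [i] (by simp)) • EuclideanSpace.proj i,
        ∑ i, ∑ k, p (MI.ofList [i, k] (by simp)) •
          tens (EuclideanSpace.proj i) (EuclideanSpace.proj k))
      map_add' := fun p q => by simp [add_smul, Finset.sum_add_distrib]
      map_smul' := fun a p => by simp [mul_smul, Finset.smul_sum] }

lemma jetOfCoord_apply (p : MI n → ℝ) :
    jetOfCoord n p = (p (MI.ofList [] (by simp)),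
      ∑ i, p (MI.ofList [i] (by simp)) • EuclideanSpace.proj i,
      ∑ i, ∑ k, p (MI.ofList [i, k] (by simp)) •
        tens (EuclideanSpace.proj i) (EuclideanSpace.proj k)) := rfl

lemma jetEval_jetOfCoord (p : MI n → ℝ) (l : List (Fin n)) (hl : l.length ≤ 2) :
    jetEval (jetOfCoord n p) l = p (MI.ofList l hl) := by
  rw [jetOfCoord_apply]
  rcases l with - | ⟨i, - | ⟨k, - | ⟨m, l⟩⟩⟩
  · rfl
  · simp [jetEval]
  · simp [jetEval, tens_apply]
  · simp at hl

lemma jetCoord_jetOfCoord (p : MI n → ℝ) : jetCoord n (jetOfCoord n p) = p := by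
  ext α
  rw [jetCoord_apply, jetEval_jetOfCoord p _ (by rw [MI.length_idx]; exact α.2), MI.ofList_idx]

lemma jetOfCoord_symm (p : MI n → ℝ) (x y : Euc n) :
    (jetOfCoord n p).2.2 x y = (jetOfCoord n p).2.2 y x := by
  have h : ∀ i k : Fin n, MI.ofList [i, k] (by simp) = MI.ofList [k, i] (by simp) := fun i k =>
    Subtype.ext (funext fun j => (List.Perm.swap k i []).count_eq j)
  simp only [jetOfCoord_apply, _root_.sum_apply, _root_.smul_apply, tens_apply, smul_eq_mul]
  rw [Finset.sum_comm]
  refine Finset.sum_congr rfl fun i _ => Finset.sum_congr rfl fun k _ => ?_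
  rw [h k i]
  ring

lemma jetCoord_tens (p : Euc n →L[ℝ] ℝ) (α : MI n) :
    jetCoord n (0, 0, tens p p) α =
      if ∑ i, α.1 i = 2 then ∏ i, p (EuclideanSpace.single i 1) ^ α.1 i else 0 := by
  rw [jetCoord_apply, ← MI.length_idx, ← MI.prod_idx α.1 fun i => p (EuclideanSpace.single i 1)]
  rcases MI.idx α.1 with - | ⟨i, - | ⟨k, - | ⟨m, l⟩⟩⟩ <;> simp [jetEval, tens_apply]

lemma mderiv_eq_jetCoord {u : Euc n → ℝ} {x : Euc n} (hu : ContDiffAt ℝ 2 u x) (α : MI n) :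
    mderiv α.1 u x = jetCoord n (jet u x) α := by
  rw [jetCoord_apply, mderiv, ← MI.foldr_idx]
  have h : (MI.idx α.1).length ≤ 2 := (MI.length_idx α.1).trans_le α.2
  generalize MI.idx α.1 = l at h ⊢
  rcases l with - | ⟨i, - | ⟨k, - | ⟨m, l⟩⟩⟩
  · rfl
  · rfl
  · have h1 : DifferentiableAt ℝ (fderiv ℝ u) x :=
      (hu.fderiv_right (m := 1) (by norm_num)).differentiableAt (by simp)
    change fderiv ℝ (fun y => fderiv ℝ u y (EuclideanSpace.single k 1)) x _ =
      fderiv ℝ (fderiv ℝ u) x _ _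
    rw [fderiv_clm_apply h1 (differentiableAt_const _)]
    simp
  · simp at h

end multiIndex

/-- Loubeau, Prop. 2.4: given a smooth `F : ℝ^n × ℝ^Λ → ℝ` and `p₀ ∈ ℝ^Λ`
with `F(0, p₀) = 0` whose linearization at `(0, p₀)` is elliptic, there is a smooth
solution `u` of `F(x, ∂^α u) = 0` near `0` with prescribed 2-jet `(∂^α u(0)) = p₀`. -/
theorem stmt8 {n : ℕ} (hn : 1 ≤ n)
    (F : Euc n × (MI n → ℝ) → ℝ) (hF : ContDiff ℝ (⊤ : ℕ∞) F)
    (p₀ : MI n → ℝ)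
    (h0 : F (0, p₀) = 0)
    (hell : ∀ ξ : Euc n, ξ ≠ 0 →
      (∑ α : MI n,
        (if (∑ i, α.1 i) = 2 then
          fderiv ℝ F (0, p₀) (0, Pi.single α (1 : ℝ)) * ∏ i, ξ i ^ α.1 i
        else 0)) ≠ 0) :
    ∃ U : Set (Euc n), IsOpen U ∧ (0 : Euc n) ∈ U ∧
      ∃ u : Euc n → ℝ, ContDiffOn ℝ (⊤ : ℕ∞) u U ∧
        (∀ x ∈ U, F (x, fun α : MI n => mderiv α.1 u x) = 0) ∧
        (∀ α : MI n, mderiv α.1 u 0 = p₀ α) := by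
  have : Nontrivial (Euc n) :=
    ⟨EuclideanSpace.single ⟨0, hn⟩ 1, 0, fun h => by simpa using congrArg (fun x => x ⟨0, hn⟩) h⟩
  obtain ⟨u, hu, hu0⟩ := Hol.exists_solution hF h0 (jetCoord n) (jetOfCoord n) jetCoord_jetOfCoord
    jetOfCoord_symm (fun p hp => by
      have hξ : WithLp.toLp 2 (fun i => p (EuclideanSpace.single i 1)) ≠ (0 : Euc n) := fun h => by
        refine hp (ContinuousLinearMap.coe_injective
          ((EuclideanSpace.basisFun (Fin n) ℝ).toBasis.ext fun i => ?_))
        simpa using congrArg (fun x : Euc n => x i) h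
      have := hell _ hξ
      have hdec : ((0 : Euc n), jetCoord n (0, 0, Hol.tens p p)) =
          ∑ α, jetCoord n (0, 0, Hol.tens p p) α • ((0 : Euc n), Pi.single α (1 : ℝ)) := by
        refine Prod.ext (by simp [Prod.fst_sum]) ?_
        simp only [Prod.snd_sum, Prod.smul_snd]
        exact pi_eq_sum_univ' _
      rw [hdec, map_sum]
      refine ne_of_eq_of_ne (Finset.sum_congr rfl fun α _ => ?_) this
      rw [map_smul, jetCoord_tens]
      split_ifs <;> simp [mul_comm])
  have hle : (2 : WithTop ℕ∞) ≤ (⊤ : ℕ∞) := WithTop.coe_le_coe.2 (le_top : (2 : ℕ∞) ≤ ⊤)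
  obtain ⟨U, hU, hUo, hU0⟩ := eventually_nhds_iff.1 hu
  refine ⟨U, hUo, hU0, u, fun x hx => (hU x hx).1.contDiffWithinAt, fun x hx => ?_, fun α => ?_⟩
  · simp only [mderiv_eq_jetCoord ((hU x hx).1.of_le hle)]
    exact (hU x hx).2
  · rw [mderiv_eq_jetCoord ((hU 0 hU0).1.of_le hle), hu0]
end
end
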